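/- There is a constant α > 0 such that, when A and B are independent uniformly random subsets of X = {x_1,…,x_n} and σ_a and σ_b are independent uniformly random orderings of A and of B respectively, the probability of the event '|A| ≥ 4, |B| ≥ 4, |A△B| ≥ 4 (so that rAddPar(a,b) is defined) and every resolution refutation of rAddPar(a,b) has length at least 2^(αn)' tends to 1 as n → ∞. -/

import Mathlib

abbrev Lit (ν : Type) := ν × Bool
abbrev Clause (ν : Type) := Finset (ν × Bool)
abbrev CNF (ν : Type) := Finset (Finset (ν × Bool))

variable {ν : Type} [DecidableEq ν]

/-- Negation of a literal. -/
def negLit (l : Lit ν) : Lit ν := (l.1, !l.2)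

/-- Canonical CNF encoding of the parity constraint `l₁ ⊕ ⋯ ⊕ l_k = c` for the
literals in the list `ls`: the clauses forbid exactly the assignments under which
the number of true literals among `ls` has parity different from `c`. -/
def parityCNF (ls : List (Lit ν)) (c : Bool) : CNF ν :=
  ((Finset.univ : Finset (Fin ls.length → Bool)).filter
      (fun f => (Finset.univ.filter (fun i => f i = true)).card % 2 = (if c then 0 else 1))).image
    (fun f => Finset.univ.image (fun i => if f i then negLit (ls.get i) else ls.get i))

/-- `xor(l₁,…,l_k)`: canonical CNF encoding of `l₁ ⊕ ⋯ ⊕ l_k = 0`. -/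
def xorCNF (ls : List (Lit ν)) : CNF ν := parityCNF ls false

def clauseSat (τ : ν → Bool) (C : Clause ν) : Prop := ∃ l ∈ C, τ l.1 = l.2

def cnfSat (τ : ν → Bool) (F : CNF ν) : Prop := ∀ C ∈ F, clauseSat τ C

def Unsat (F : CNF ν) : Prop := ¬ ∃ τ : ν → Bool, cnfSat τ F

def cnfVars (F : CNF ν) : Set ν := {v | ∃ C ∈ F, ∃ b, (v, b) ∈ C}

def clauseVars (C : Clause ν) : Set ν := {v | ∃ b, (v, b) ∈ C}

/-- `R` is the resolvent of `C` and `D`. -/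
def IsResolvent (C D R : Clause ν) : Prop :=
  ∃ v : ν, (v, true) ∈ C ∧ (v, false) ∈ D ∧ R = C.erase (v, true) ∪ D.erase (v, false)

/-- A resolution refutation of `F`: a sequence of clauses, each an axiom of `F` or a
resolvent of two earlier clauses, ending with the empty clause. Its length is `L.length`. -/
def IsResRefutation (F : CNF ν) (L : List (Clause ν)) : Prop :=
  L ≠ [] ∧ L.getLast? = some (∅ : Clause ν) ∧
    ∀ i, (hi : i < L.length) →
      L[i] ∈ F ∨ ∃ j k, ∃ (hj : j < i) (hk : k < i),
        IsResolvent (L[j]'(hj.trans hi)) (L[k]'(hk.trans hi)) L[i]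

/-- The `j`-th xor constraint (0-based) of `Parity(xs, t)`: for a list `xs` of `n ≥ 4`
literals and Tseitin variables `t 0, …, t (n-4)`, constraint `0` is
`xor(xs[0], xs[1], t 0)`, constraint `j` for `1 ≤ j ≤ n-4` is
`xor(t (j-1), xs[j+1], t j)`, and constraint `n-3` is `xor(t (n-4), xs[n-2], xs[n-1])`. -/
def parityCtr (xs : List (Lit ν)) (t : ℕ → ν) (j : ℕ) : List (Lit ν) :=
  if j = 0 then [xs.getD 0 (t 0, true), xs.getD 1 (t 0, true), (t 0, true)]
  else if j < xs.length - 3 then [(t (j - 1), true), xs.getD (j + 1) (t 0, true), (t j, true)]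
  else [(t (xs.length - 4), true), xs.getD (xs.length - 2) (t 0, true),
    xs.getD (xs.length - 1) (t 0, true)]

/-- The standard linear CNF encoding `Parity(xs, t)` of the parity constraint
`xs[0] ⊕ ⋯ ⊕ xs[n-1] = 0` using Tseitin variables `t 0, …, t (n-4)`. -/
def ParityCNF (xs : List (Lit ν)) (t : ℕ → ν) : CNF ν :=
  (Finset.range (xs.length - 2)).biUnion (fun j => xorCNF (parityCtr xs t j))

/-- The elements of `A` listed in the order induced by the permutation `σ`. -/
def orderedElems {n : ℕ} (A : Finset (Fin n)) (σ : Equiv.Perm (Fin n)) : List (Fin n) :=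
  (List.ofFn (fun i => σ i)).filter (fun i => decide (i ∈ A))

/-- Positive literals for a list of variables, variable `i : Fin n` encoded as `(i : ℕ)`. -/
def posLits {n : ℕ} (l : List (Fin n)) : List (Lit ℕ) := l.map (fun i => ((i : ℕ), true))

/-- The literals of `C`: the symmetric difference `A △ B` in the order induced by `σc`,
all positive except that the literal on the maximal element of `A △ B` is flipped. -/
def symmLits {n : ℕ} (A B : Finset (Fin n)) (σc : Equiv.Perm (Fin n)) : List (Lit ℕ) :=
  (orderedElems (symmDiff A B) σc).map
    (fun (i : Fin n) => ((i : ℕ), decide ((i : WithBot (Fin n)) ≠ (symmDiff A B).max)))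

/-- `rAddPar(a, b, σc) = Parity(A, S, σa) ∧ Parity(B, T, σb) ∧ Parity(C, U, σc)` where
`C` is `A △ B` with one literal flipped; `S`, `T`, `U` are encoded as `n + k`, `2n + k`,
`3n + k` respectively. -/
def rAddPar (n : ℕ) (A B : Finset (Fin n)) (σa σb σc : Equiv.Perm (Fin n)) : CNF ℕ :=
  ParityCNF (posLits (orderedElems A σa)) (fun k => n + k) ∪
    ParityCNF (posLits (orderedElems B σb)) (fun k => 2 * n + k) ∪
    ParityCNF (symmLits A B σc) (fun k => 3 * n + k)

section SizeWidth

/-- Live literals of a clause. -/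
noncomputable def liveLits (H : Set (Finset (Lit ν))) (ρ : Finset (Lit ν)) (D : Clause ν) :
    Finset (Lit ν) :=
  open Classical in D.filter (fun l => insert l ρ ∈ H ∧ insert (negLit l) ρ ∈ H)

/-- Clauses that can still be falsified literalwise. -/
def openClause (H : Set (Finset (Lit ν))) (ρ : Finset (Lit ν)) (D : Clause ν) : Prop :=
  ∀ l ∈ D, insert (negLit l) ρ ∈ H

noncomputable def fatClauses (H : Set (Finset (Lit ν))) (Ls : Finset (Clause ν)) (d : ℕ)
    (ρ : Finset (Lit ν)) : Finset (Clause ν) :=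
  open Classical in Ls.filter (fun D => openClause H ρ D ∧ d ≤ (liveLits H ρ D).card)

lemma negLit_negLit (l : Lit ν) : negLit (negLit l) = l := by
  simp [negLit]

lemma mem_liveLits {H : Set (Finset (Lit ν))} {ρ : Finset (Lit ν)} {D : Clause ν} {l : Lit ν} :
    l ∈ liveLits H ρ D ↔ l ∈ D ∧ insert l ρ ∈ H ∧ insert (negLit l) ρ ∈ H := by
  classical
  simp [liveLits]

lemma mem_fatClauses {H : Set (Finset (Lit ν))} {Ls : Finset (Clause ν)} {d : ℕ}
    {ρ : Finset (Lit ν)} {D : Clause ν} :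
    D ∈ fatClauses H Ls d ρ ↔ D ∈ Ls ∧ openClause H ρ D ∧ d ≤ (liveLits H ρ D).card := by
  classical
  simp [fatClauses]

lemma fat_step (H : Set (Finset (Lit ν))) (Ls : Finset (Clause ν)) (d : ℕ)
    (V : Finset (Lit ν)) (hV0 : 0 < V.card)
    (hdown : ∀ η ∈ H, ∀ η' ⊆ η, η' ∈ H)
    (hcons : ∀ η ∈ H, ∀ l ∈ η, negLit l ∉ η)
    (hV : ∀ C ∈ Ls, C ⊆ V) (ρ : Finset (Lit ν)) (hρ : ρ ∈ H) :
    ∃ ρ' ∈ H, ρ'.card ≤ ρ.card + 1 ∧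
      ((fatClauses H Ls d ρ').card : ℝ) ≤ (1 - d / V.card) * (fatClauses H Ls d ρ).card := by
  classical
  set Ft := fatClauses H Ls d ρ with hFt
  have hVr : (0 : ℝ) < V.card := by exact_mod_cast hV0
  -- averaging
  have havg : ∃ l ∈ V, d * Ft.card ≤ (Ft.filter (fun D => l ∈ liveLits H ρ D)).card * V.card := by
    by_contra hcon
    push Not at hcon
    have h1 : ∑ l ∈ V, (Ft.filter (fun D => l ∈ liveLits H ρ D)).card
        = ∑ D ∈ Ft, (V.filter (fun l => l ∈ liveLits H ρ D)).card := by
      simp only [Finset.card_filter]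
      exact Finset.sum_comm
    have h2 : ∀ D ∈ Ft, d ≤ (V.filter (fun l => l ∈ liveLits H ρ D)).card := by
      intro D hD
      have hD' := mem_fatClauses.1 hD
      refine hD'.2.2.trans (Finset.card_le_card ?_)
      intro l hl
      exact Finset.mem_filter.2 ⟨hV D hD'.1 (mem_liveLits.1 hl).1, hl⟩
    have h3 : d * Ft.card ≤ ∑ l ∈ V, (Ft.filter (fun D => l ∈ liveLits H ρ D)).card := by
      rw [h1]
      calc d * Ft.card = ∑ D ∈ Ft, d := by simp [mul_comm]
        _ ≤ _ := Finset.sum_le_sum h2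
    have h4 : ∑ l ∈ V, (Ft.filter (fun D => l ∈ liveLits H ρ D)).card * V.card
        < ∑ l ∈ V, d * Ft.card :=
      Finset.sum_lt_sum_of_nonempty (Finset.card_pos.1 hV0) hcon
    rw [← Finset.sum_mul] at h4
    simp only [Finset.sum_const, smul_eq_mul] at h4
    nlinarith
  obtain ⟨l, hlV, hl⟩ := havg
  set K := Ft.filter (fun D => l ∈ liveLits H ρ D) with hK
  have hKr : (d : ℝ) * Ft.card ≤ K.card * V.card := by exact_mod_cast hl
  have hKr' : (d : ℝ) / V.card * Ft.card ≤ K.card := by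
    rw [div_mul_eq_mul_div, div_le_iff₀ hVr]; exact hKr
  by_cases hK0 : K.card = 0
  · refine ⟨ρ, hρ, by omega, ?_⟩
    rw [hK0] at hKr'
    push_cast at hKr'
    have : (1 - (d : ℝ) / V.card) * Ft.card = Ft.card - (d : ℝ) / V.card * Ft.card := by ring
    rw [this]; linarith
  · obtain ⟨D0, hD0⟩ := Finset.card_pos.1 (Nat.pos_of_ne_zero hK0)
    have hlive := mem_liveLits.1 (Finset.mem_filter.1 hD0).2
    refine ⟨insert l ρ, hlive.2.1, Finset.card_insert_le _ _, ?_⟩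
    have hsub : fatClauses H Ls d (insert l ρ) ⊆ Ft \ K := by
      intro D hD
      have hD' := mem_fatClauses.1 hD
      rw [Finset.mem_sdiff]
      constructor
      · refine mem_fatClauses.2 ⟨hD'.1, ?_, hD'.2.2.trans (Finset.card_le_card ?_)⟩
        · intro m hm
          exact hdown _ (hD'.2.1 m hm) _ (by
            intro x hx; simp only [Finset.mem_insert] at hx ⊢; tauto)
        · intro m hm
          have hm' := mem_liveLits.1 hm
          refine mem_liveLits.2 ⟨hm'.1, hdown _ hm'.2.1 _ ?_, hdown _ hm'.2.2 _ ?_⟩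
          · intro x hx; simp only [Finset.mem_insert] at hx ⊢; tauto
          · intro x hx; simp only [Finset.mem_insert] at hx ⊢; tauto
      · intro hDK
        have h1 := mem_liveLits.1 (Finset.mem_filter.1 hDK).2
        have h2 := hD'.2.1 l h1.1
        exact hcons _ h2 l (by simp) (by simp)
    have hKF : K ⊆ Ft := Finset.filter_subset _ _
    have hc := Finset.card_le_card hsub
    rw [Finset.card_sdiff_of_subset hKF] at hc
    have hc2 := Finset.card_le_card hKF
    have hc3 : ((fatClauses H Ls d (insert l ρ)).card : ℝ) ≤ Ft.card - K.card := by
      have : (fatClauses H Ls d (insert l ρ)).card + K.card ≤ Ft.card := by omega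
      have : ((fatClauses H Ls d (insert l ρ)).card : ℝ) + K.card ≤ Ft.card := by exact_mod_cast this
      linarith
    have : (1 - (d : ℝ) / V.card) * Ft.card = Ft.card - (d : ℝ) / V.card * Ft.card := by ring
    rw [this]; linarith

/-- Extending the falsification over literals whose negations are forced. -/
lemma extend_forced (H : Set (Finset (Lit ν))) (w : ℕ)
    (hdown : ∀ η ∈ H, ∀ η' ⊆ η, η' ∈ H)
    (hext : ∀ η ∈ H, η.card < w → ∀ v, ∃ b, insert (v, b) η ∈ H)
    (ρ : Finset (Lit ν)) (P : Finset (Lit ν)) (hP : ∀ l ∈ P, insert l ρ ∉ H) :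
    ∀ η ∈ H, ρ ⊆ η → η.card + P.card ≤ w → η ∪ P.image negLit ∈ H := by
  classical
  induction P using Finset.induction_on with
  | empty => intro η hη _ _; simpa using hη
  | insert l P hl ih =>
    intro η hη hρη hcard
    rw [Finset.card_insert_of_notMem hl] at hcard
    obtain ⟨b, hb⟩ := hext η hη (by omega) l.1
    have hlb : (l.1, b) = negLit l := by
      by_contra hne
      have : (l.1, b) = l := by
        rcases l with ⟨v, c⟩
        simp only [negLit, Prod.mk.injEq, true_and] at hne ⊢
        cases b <;> cases c <;> simp_all
      rw [this] at hb
      refine hP l (by simp) (hdown _ hb _ ?_)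
      exact Finset.insert_subset_insert _ hρη
    rw [hlb] at hb
    have := ih (fun m hm => hP m (by simp [hm])) _ hb
      (hρη.trans (Finset.subset_insert _ _))
      ((Nat.add_le_add_right (Finset.card_insert_le _ _) _).trans (by omega))
    rw [Finset.image_insert]
    refine hdown _ this _ ?_
    intro x hx
    simp only [Finset.mem_union, Finset.mem_insert] at hx ⊢
    tauto

lemma refutation_lits_subset {F : CNF ν} {L : List (Clause ν)} (hL : IsResRefutation F L)
    (V : Finset (Lit ν)) (hV : ∀ C ∈ F, C ⊆ V) : ∀ C ∈ L, C ⊆ V := by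
  have key : ∀ i, (hi : i < L.length) → L[i] ⊆ V := by
    intro i
    induction i using Nat.strong_induction_on with
    | _ i ih =>
      intro hi
      rcases hL.2.2 i hi with h | ⟨j, k, hj, hk, v, hv1, hv2, hR⟩
      · exact hV _ h
      · rw [hR]
        exact Finset.union_subset ((Finset.erase_subset _ _).trans (ih j hj _))
          ((Finset.erase_subset _ _).trans (ih k hk _))
  intro C hC
  obtain ⟨i, hi, rfl⟩ := List.mem_iff_getElem.1 hC
  exact key i hi

/-- Size-width trade-off, in the language of winning strategies. -/
theorem size_width (F : CNF ν) (H : Set (Finset (Lit ν))) (w k d : ℕ) (V : Finset (Lit ν))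
    (hempty : ∅ ∈ H)
    (hdown : ∀ η ∈ H, ∀ η' ⊆ η, η' ∈ H)
    (hcons : ∀ η ∈ H, ∀ l ∈ η, negLit l ∉ η)
    (hext : ∀ η ∈ H, η.card < w → ∀ v, ∃ b, insert (v, b) η ∈ H)
    (hax : ∀ C ∈ F, ∀ η ∈ H, ¬ C.image negLit ⊆ η)
    (hax3 : ∀ C ∈ F, C.card ≤ 3)
    (hkd : k + d + 3 ≤ w) (hV0 : 0 < V.card) (hdV : d ≤ V.card)
    (hV : ∀ C ∈ F, C ⊆ V) (L : List (Clause ν)) (hL : IsResRefutation F L) :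
    1 ≤ (1 - (d : ℝ) / V.card) ^ k * L.length := by
  classical
  by_contra hlt
  push Not at hlt
  have hVr : (0 : ℝ) < V.card := by exact_mod_cast hV0
  have hq : (0 : ℝ) ≤ 1 - (d : ℝ) / V.card := by
    rw [sub_nonneg, div_le_one hVr]; exact_mod_cast hdV
  have hLV := refutation_lits_subset hL V hV
  have greedy : ∀ j : ℕ, ∃ ρ ∈ H, ρ.card ≤ j ∧
      ((fatClauses H L.toFinset d ρ).card : ℝ) ≤ (1 - (d : ℝ) / V.card) ^ j * L.length := by
    intro j
    induction j with
    | zero =>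
      refine ⟨∅, hempty, by simp, ?_⟩
      simp only [pow_zero, one_mul]
      have h1 : (fatClauses H L.toFinset d ∅).card ≤ L.toFinset.card :=
        Finset.card_le_card (Finset.filter_subset _ _)
      exact_mod_cast h1.trans (List.toFinset_card_le L)
    | succ j ih =>
      obtain ⟨ρ, hρ, hc, hf⟩ := ih
      obtain ⟨ρ', hρ', hc', hf'⟩ := fat_step H L.toFinset d V hV0 hdown hcons
        (fun C hC => hLV C (List.mem_toFinset.1 hC)) ρ hρ
      refine ⟨ρ', hρ', by omega, hf'.trans ?_⟩
      rw [pow_succ, mul_comm (_ ^ j), mul_assoc]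
      exact mul_le_mul_of_nonneg_left hf hq
  obtain ⟨ρ, hρ, hρc, hfat⟩ := greedy k
  have hfat0 : fatClauses H L.toFinset d ρ = ∅ := by
    have : ((fatClauses H L.toFinset d ρ).card : ℝ) < 1 := lt_of_le_of_lt hfat hlt
    have : (fatClauses H L.toFinset d ρ).card < 1 := by exact_mod_cast this
    exact Finset.card_eq_zero.1 (by omega)
  have hthin : ∀ D ∈ L, openClause H ρ D → (liveLits H ρ D).card < d := by
    intro D hD ho
    by_contra hge
    have : D ∈ fatClauses H L.toFinset d ρ :=
      mem_fatClauses.2 ⟨List.mem_toFinset.2 hD, ho, by omega⟩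
    simp [hfat0] at this
  -- no clause of the refutation is bad
  have nobad : ∀ i, (hi : i < L.length) →
      ¬ (openClause H ρ L[i] ∧ ρ ∪ (liveLits H ρ L[i]).image negLit ∈ H) := by
    intro i
    induction i using Nat.strong_induction_on with
    | _ i ih =>
      rintro hi ⟨ho, hb⟩
      have hth := hthin _ (List.getElem_mem hi) ho
      have hcard : (ρ ∪ (liveLits H ρ L[i]).image negLit).card < k + d := by
        have h1 := Finset.card_union_le ρ ((liveLits H ρ L[i]).image negLit)
        have h2 : ((liveLits H ρ L[i]).image negLit).card ≤ _ := Finset.card_image_le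
        omega
      rcases hL.2.2 i hi with h | ⟨j, kk, hj, hkk, v, hv1, hv2, hR⟩
      · -- clause of the formula
        set P := L[i].filter (fun l => insert l ρ ∉ H) with hPdef
        have hP3 : P.card ≤ 3 := (Finset.card_filter_le _ _).trans (hax3 _ h)
        have := extend_forced H w hdown hext ρ P (fun l hl => (Finset.mem_filter.1 hl).2)
          _ hb Finset.subset_union_left (by omega)
        refine hax _ h _ this ?_
        intro x hx
        obtain ⟨l, hl, rfl⟩ := Finset.mem_image.1 hx
        by_cases hlH : insert l ρ ∈ H
        · have : l ∈ liveLits H ρ L[i] := mem_liveLits.2 ⟨hl, hlH, ho l hl⟩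
          simp only [Finset.mem_union]
          exact Or.inl (Or.inr (Finset.mem_image_of_mem _ this))
        · have : l ∈ P := Finset.mem_filter.2 ⟨hl, hlH⟩
          simp only [Finset.mem_union]
          exact Or.inr (Finset.mem_image_of_mem _ this)
      · -- resolvent
        have aux : ∀ (D : Clause ν) (l : Lit ν), (∀ m ∈ D, m = l ∨ m ∈ L[i]) →
            insert (negLit l) (ρ ∪ (liveLits H ρ L[i]).image negLit) ∈ H →
            openClause H ρ D ∧ ρ ∪ (liveLits H ρ D).image negLit ∈ H := by
          intro D l hD hins
          constructor
          · intro m hm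
            rcases hD m hm with rfl | hm'
            · refine hdown _ hins _ (Finset.insert_subset_insert _ Finset.subset_union_left)
            · exact ho m hm'
          · refine hdown _ hins _ ?_
            intro x hx
            rcases Finset.mem_union.1 hx with hx | hx
            · simp [hx]
            · obtain ⟨m, hm, rfl⟩ := Finset.mem_image.1 hx
              have hm' := mem_liveLits.1 hm
              rcases hD m hm'.1 with rfl | hmi
              · simp
              · refine Finset.mem_insert_of_mem (Finset.mem_union_right _ ?_)
                exact Finset.mem_image_of_mem _ (mem_liveLits.2 ⟨hmi, hm'.2⟩)
        obtain ⟨b, hbv⟩ := hext _ hb (by omega) v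
        cases b with
        | false =>
          refine ih j hj (hj.trans hi) (aux (L[j]'(hj.trans hi)) (v, true) ?_ (by simpa [negLit] using hbv))
          intro m hm
          by_cases hmv : m = (v, true)
          · exact Or.inl hmv
          · right; rw [hR]; simp [hm, hmv]
        | true =>
          refine ih kk hkk (hkk.trans hi) (aux (L[kk]'(hkk.trans hi)) (v, false) ?_ (by simpa [negLit] using hbv))
          intro m hm
          by_cases hmv : m = (v, false)
          · exact Or.inl hmv
          · right; rw [hR]; simp [hm, hmv]
  have hne := hL.1
  have hpos : 0 < L.length := List.length_pos_iff.2 hne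
  have hlast : L[L.length - 1]'(by omega) = ∅ := by
    have := hL.2.1
    rw [List.getLast?_eq_getElem?, List.getElem?_eq_getElem (by omega)] at this
    exact Option.some.inj this
  refine nobad (L.length - 1) (by omega) ?_
  rw [hlast]
  refine ⟨by intro l hl; simp at hl, ?_⟩
  have : liveLits H ρ ∅ = ∅ := by simp [liveLits]
  rw [this]; simpa using hρ

end SizeWidth

section Strategy

/-- Flip the value of one variable. -/
def flipVar (τ : ν → Bool) (v : ν) : ν → Bool := Function.update τ v (!τ v)

/-- `v` toggles the constraint `P`. -/
def Toggles (v : ν) (P : (ν → Bool) → Prop) : Prop := ∀ τ, P (flipVar τ v) ↔ ¬ P τ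

/-- `v` does not influence the constraint `P`. -/
def Neutral (v : ν) (P : (ν → Bool) → Prop) : Prop := ∀ τ, P (flipVar τ v) ↔ P τ

/-- Expanding parity constraints require long refutations. -/
theorem expansion_size {J : Type} [DecidableEq J] (F : CNF ν) (w k d T : ℕ)
    (V : Finset (Lit ν))
    (base : (ν → Bool) → Prop) (sat : J → (ν → Bool) → Prop) (wt : Finset J → ℕ)
    (wt_mono : ∀ S S' : Finset J, S ⊆ S' → wt S ≤ wt S')
    (wt_union : ∀ S S' : Finset J, wt (S ∪ S') ≤ wt S + wt S')
    (wt_empty : wt ∅ ≤ T)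
    (wt_sing : ∀ u, wt {u} ≤ T)
    (hax : ∀ C ∈ F, (∀ τ, base τ → clauseSat τ C) ∨ ∃ u, ∀ τ, sat u τ → clauseSat τ C)
    (hsat : ∀ S, wt S ≤ T → ∃ τ, base τ ∧ ∀ u ∈ S, sat u τ)
    (hexp : ∀ S, T < wt S → wt S ≤ 2 * T → ∃ E : Finset ν, w ≤ E.card ∧
      ∀ v ∈ E, Neutral v base ∧ ∃ u ∈ S, Toggles v (sat u) ∧
        ∀ u' ∈ S, u' ≠ u → Neutral v (sat u'))
    (hax3 : ∀ C ∈ F, C.card ≤ 3)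
    (hkd : k + d + 3 ≤ w) (hV0 : 0 < V.card) (hdV : d ≤ V.card)
    (hV : ∀ C ∈ F, C ⊆ V) (L : List (Clause ν)) (hL : IsResRefutation F L) :
    1 ≤ (1 - (d : ℝ) / V.card) ^ k * L.length := by
  classical
  set ok : Finset J → Finset (Lit ν) → Prop := fun S η =>
    ∃ τ, base τ ∧ (∀ u ∈ S, sat u τ) ∧ ∀ l ∈ η, τ l.1 = l.2 with hok
  set H : Set (Finset (Lit ν)) := {η | η.card ≤ w ∧ ∀ S, wt S ≤ T → ok S η} with hH
  refine size_width F H w k d V ?_ ?_ ?_ ?_ ?_ hax3 hkd hV0 hdV hV L hL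
  · refine ⟨by simp, fun S hS => ?_⟩
    obtain ⟨τ, h1, h2⟩ := hsat S hS
    exact ⟨τ, h1, h2, by simp⟩
  · rintro η ⟨hc, hη⟩ η' hsub
    refine ⟨(Finset.card_le_card hsub).trans hc, fun S hS => ?_⟩
    obtain ⟨τ, h1, h2, h3⟩ := hη S hS
    exact ⟨τ, h1, h2, fun l hl => h3 l (hsub hl)⟩
  · rintro η ⟨hc, hη⟩ l hl hnl
    obtain ⟨τ, h1, h2, h3⟩ := hη ∅ wt_empty
    have a := h3 l hl
    have b := h3 _ hnl
    simp only [negLit] at b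
    rw [a] at b
    cases h : l.2 <;> simp [h] at b
  · rintro η ⟨hc, hη⟩ hlt v
    by_contra hcon
    push Not at hcon
    have hS : ∀ b, ∃ S, wt S ≤ T ∧ ¬ ok S (insert (v, b) η) := by
      intro b
      by_contra hcon2
      push Not at hcon2
      exact hcon b ⟨(Finset.card_insert_le _ _).trans (by omega), hcon2⟩
    choose S hST hSn using hS
    have hun : ¬ ok (S false ∪ S true) η := by
      rintro ⟨τ, h1, h2, h3⟩
      refine hSn (τ v) ⟨τ, h1, ?_, ?_⟩
      · intro u hu
        apply h2
        cases h : τ v <;> rw [h] at hu <;> simp [hu]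
      · intro l hl
        rcases Finset.mem_insert.1 hl with rfl | hl
        · rfl
        · exact h3 l hl
    obtain ⟨R, hRsub, hRmin⟩ := exists_minimal_le_of_wellFoundedLT
      (fun R : Finset J => ¬ ok R η) _ hun
    have hRT : T < wt R := by
      by_contra hle
      exact hRmin.1 (hη R (by omega))
    have hR2 : wt R ≤ 2 * T := by
      have a := wt_mono _ _ hRsub
      have b := wt_union (S false) (S true)
      have c := hST false
      have d := hST true
      omega
    obtain ⟨E, hE, hE'⟩ := hexp R hRT hR2
    have hEsub : E ⊆ η.image Prod.fst := by
      intro e he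
      obtain ⟨hb, u, hu, htog, hneu⟩ := hE' e he
      by_contra hne
      have hok' : ok (R.erase u) η := by
        by_contra hno
        have := hRmin.2 hno (Finset.erase_subset u R)
        exact (Finset.notMem_erase u R) (this hu)
      obtain ⟨τ, h1, h2, h3⟩ := hok'
      have hnu : ¬ sat u τ := by
        intro hs
        refine hRmin.1 ⟨τ, h1, ?_, h3⟩
        intro u' hu'
        by_cases h : u' = u
        · rw [h]; exact hs
        · exact h2 u' (Finset.mem_erase.2 ⟨h, hu'⟩)
      refine hRmin.1 ⟨flipVar τ e, (hb τ).2 h1, ?_, ?_⟩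
      · intro u' hu'
        by_cases h : u' = u
        · rw [h]; exact (htog τ).2 hnu
        · exact (hneu u' hu' h τ).2 (h2 u' (Finset.mem_erase.2 ⟨h, hu'⟩))
      · intro l hl
        have hle : l.1 ≠ e := by
          rintro rfl
          exact hne (Finset.mem_image_of_mem _ hl)
        simp only [flipVar, Function.update_of_ne hle]
        exact h3 l hl
    have h1 := Finset.card_le_card hEsub
    have h2 : (η.image Prod.fst).card ≤ η.card := Finset.card_image_le
    omega
  · rintro C hC η ⟨hc, hη⟩ hsub
    have fin : ∀ τ, (∀ l ∈ η, τ l.1 = l.2) → ¬ clauseSat τ C := by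
      rintro τ h3 ⟨l, hl, hl'⟩
      have := h3 _ (hsub (Finset.mem_image_of_mem _ hl))
      simp only [negLit] at this
      rw [hl'] at this
      cases h : l.2 <;> simp [h] at this
    rcases hax C hC with hb | ⟨u, hu⟩
    · obtain ⟨τ, h1, h2, h3⟩ := hη ∅ wt_empty
      exact fin τ h3 (hb τ h1)
    · obtain ⟨τ, h1, h2, h3⟩ := hη {u} (wt_sing u)
      exact fin τ h3 (hu τ (h2 u (by simp)))

end Strategy

section Chain

/-- The parity of the number of true literals in a list. -/
def xorv (τ : ν → Bool) (ls : List (Lit ν)) : Bool :=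
  (ls.map (fun l => (τ l.1 == l.2))).foldr xor false

/-- The parity of the number of occurrences of a variable. -/
def occv (v : ν) (ls : List (Lit ν)) : Bool :=
  (ls.map (fun l => decide (l.1 = v))).foldr xor false

lemma xorv_append (τ : ν → Bool) (l l' : List (Lit ν)) :
    xorv τ (l ++ l') = xor (xorv τ l) (xorv τ l') := by
  induction l with
  | nil => simp [xorv]
  | cons a l ih =>
    simp only [xorv, List.cons_append, List.map_cons, List.foldr_cons] at ih ⊢
    rw [ih, Bool.xor_assoc]

lemma xorv_flip (τ : ν → Bool) (v : ν) (ls : List (Lit ν)) :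
    xorv (flipVar τ v) ls = xor (xorv τ ls) (occv v ls) := by
  induction ls with
  | nil => simp [xorv, occv]
  | cons a l ih =>
    simp only [xorv, occv, List.map_cons, List.foldr_cons] at ih ⊢
    rw [ih]
    have : (flipVar τ v a.1 == a.2) = xor (τ a.1 == a.2) (decide (a.1 = v)) := by
      by_cases h : a.1 = v
      · subst h
        simp only [flipVar, Function.update_self, decide_true]
        cases τ a.1 <;> cases a.2 <;> rfl
      · simp [flipVar, Function.update_of_ne h, h]
    rw [this]
    generalize (τ a.1 == a.2) = x
    generalize (decide (a.1 = v)) = y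
    generalize List.foldr xor false (List.map (fun l => τ l.1 == l.2) l) = z
    generalize List.foldr xor false (List.map (fun l => decide (l.1 = v)) l) = u
    revert x y z u; decide

lemma xorCNF_sound (τ : ν → Bool) (l1 l2 l3 : Lit ν) (C : Clause ν)
    (hC : C ∈ xorCNF [l1, l2, l3]) (h : xorv τ [l1, l2, l3] = false) : clauseSat τ C := by
  classical
  by_contra hcon
  simp only [xorCNF, parityCNF, Finset.mem_image, Finset.mem_filter, Finset.mem_univ,
    true_and] at hC
  obtain ⟨f, hf, rfl⟩ := hC
  have key : ∀ i : Fin 3, (τ (([l1, l2, l3] : List (Lit ν)).get i).1 == (([l1, l2, l3] : List (Lit ν)).get i).2) = f i := by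
    intro i
    by_contra hne
    refine hcon ⟨_, Finset.mem_image_of_mem _ (Finset.mem_univ i), ?_⟩
    cases hfi : f i
    · rw [hfi] at hne; simpa using hne
    · rw [hfi] at hne
      simp only [negLit, if_true]
      revert hne
      generalize τ (([l1, l2, l3] : List (Lit ν)).get i).1 = x
      generalize (([l1, l2, l3] : List (Lit ν)).get i).2 = y
      revert x y; decide
  have k0 := key 0
  have k1 := key 1
  have k2 := key 2
  simp only [xorv, List.map_cons, List.map_nil, List.foldr_cons, List.foldr_nil] at h
  change (τ l1.1 == l1.2) = f 0 at k0
  change (τ l2.1 == l2.2) = f 1 at k1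
  change (τ l3.1 == l3.2) = f 2 at k2
  rw [k0, k1, k2] at h
  change (Finset.univ.filter (fun i : Fin 3 => f i = true)).card % 2 = 1 at hf
  revert h hf
  have : ∀ f : Fin 3 → Bool, (Finset.univ.filter (fun i : Fin 3 => f i = true)).card % 2 = 1 →
      ¬ xor (f 0) (xor (f 1) (xor (f 2) false)) = false := by decide
  intro h hf
  exact this f hf h

lemma xorCNF_card (ls : List (Lit ν)) (C : Clause ν) (hC : C ∈ xorCNF ls) :
    C.card ≤ ls.length := by
  simp only [xorCNF, parityCNF, Finset.mem_image] at hC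
  obtain ⟨f, hf, rfl⟩ := hC
  exact Finset.card_image_le.trans (by simp)

lemma xorCNF_vars (ls : List (Lit ν)) (C : Clause ν) (hC : C ∈ xorCNF ls) :
    ∀ l ∈ C, ∃ m ∈ ls, m.1 = l.1 := by
  simp only [xorCNF, parityCNF, Finset.mem_image] at hC
  obtain ⟨f, hf, rfl⟩ := hC
  intro l hl
  obtain ⟨i, -, rfl⟩ := Finset.mem_image.1 hl
  refine ⟨ls.get i, List.get_mem _ _, ?_⟩
  split <;> simp [negLit]

/-- Constraint number `j` of a chain holds. -/
def ctrOK (xs : List (Lit ν)) (t : ℕ → ν) (j : ℕ) (τ : ν → Bool) : Prop :=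
  j < xs.length - 2 → xorv τ (parityCtr xs t j) = false

lemma parityCtr_three (xs : List (Lit ν)) (t : ℕ → ν) (j : ℕ) :
    ∃ l1 l2 l3, parityCtr xs t j = [l1, l2, l3] := by
  unfold parityCtr
  split_ifs <;> exact ⟨_, _, _, rfl⟩

lemma ctrOK_sound (xs : List (Lit ν)) (t : ℕ → ν) (C : Clause ν) (hC : C ∈ ParityCNF xs t) :
    ∃ j, ∀ τ, ctrOK xs t j τ → clauseSat τ C := by
  simp only [ParityCNF, Finset.mem_biUnion, Finset.mem_range] at hC
  obtain ⟨j, hj, hC⟩ := hC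
  refine ⟨j, fun τ h => ?_⟩
  obtain ⟨l1, l2, l3, h3⟩ := parityCtr_three xs t j
  have := h hj
  rw [h3] at hC this
  exact xorCNF_sound τ l1 l2 l3 C hC this

lemma ParityCNF_card (xs : List (Lit ν)) (t : ℕ → ν) (C : Clause ν) (hC : C ∈ ParityCNF xs t) :
    C.card ≤ 3 := by
  simp only [ParityCNF, Finset.mem_biUnion, Finset.mem_range] at hC
  obtain ⟨j, hj, hC⟩ := hC
  obtain ⟨l1, l2, l3, h3⟩ := parityCtr_three xs t j
  rw [h3] at hC
  exact xorCNF_card _ C hC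

lemma parityCtr_vars (xs : List (Lit ν)) (t : ℕ → ν) (h4 : 4 ≤ xs.length) (j : ℕ)
    (hj : j < xs.length - 2) (m : Lit ν) (hm : m ∈ parityCtr xs t j) :
    m ∈ xs ∨ ∃ k, k < xs.length - 3 ∧ m.1 = t k := by
  unfold parityCtr at hm
  have hX : ∀ p, p < xs.length → xs.getD p (t 0, true) ∈ xs := by
    intro p hp
    rw [List.getD_eq_getElem _ _ hp]; exact List.getElem_mem hp
  split_ifs at hm with h1 h2 <;> simp only [List.mem_cons, List.not_mem_nil, or_false] at hm <;>
    rcases hm with rfl | rfl | rfl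
  · exact Or.inl (hX _ (by omega))
  · exact Or.inl (hX _ (by omega))
  · exact Or.inr ⟨0, by omega, rfl⟩
  · exact Or.inr ⟨_, by omega, rfl⟩
  · exact Or.inl (hX _ (by omega))
  · exact Or.inr ⟨_, by omega, rfl⟩
  · exact Or.inr ⟨_, by omega, rfl⟩
  · exact Or.inl (hX _ (by omega))
  · exact Or.inl (hX _ (by omega))

lemma ParityCNF_vars (xs : List (Lit ν)) (t : ℕ → ν) (h4 : 4 ≤ xs.length) (C : Clause ν)
    (hC : C ∈ ParityCNF xs t) (l : Lit ν) (hl : l ∈ C) :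
    (∃ m ∈ xs, m.1 = l.1) ∨ ∃ k, k < xs.length - 3 ∧ l.1 = t k := by
  simp only [ParityCNF, Finset.mem_biUnion, Finset.mem_range] at hC
  obtain ⟨j, hj, hC⟩ := hC
  obtain ⟨m, hm, hml⟩ := xorCNF_vars _ C hC l hl
  rcases parityCtr_vars xs t h4 j hj m hm with h | ⟨k, hk, h⟩
  · exact Or.inl ⟨m, h, hml⟩
  · exact Or.inr ⟨k, hk, by rw [← hml, h]⟩

lemma ctrOK_toggles (xs : List (Lit ν)) (t : ℕ → ν) (j : ℕ) (v : ν) (hj : j < xs.length - 2)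
    (h : occv v (parityCtr xs t j) = true) : Toggles v (ctrOK xs t j) := by
  intro τ
  simp only [ctrOK, hj, true_imp_iff, xorv_flip, h]
  cases xorv τ (parityCtr xs t j) <;> simp

lemma ctrOK_neutral (xs : List (Lit ν)) (t : ℕ → ν) (j : ℕ) (v : ν)
    (h : j < xs.length - 2 → occv v (parityCtr xs t j) = false) : Neutral v (ctrOK xs t j) := by
  intro τ
  refine imp_congr_right fun hj => ?_
  rw [xorv_flip, h hj]; simp

lemma occv_of_notMem (v : ν) (ls : List (Lit ν)) (h : ∀ m ∈ ls, m.1 ≠ v) : occv v ls = false := by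
  induction ls with
  | nil => rfl
  | cons a l ih =>
    simp only [occv, List.map_cons, List.foldr_cons] at ih ⊢
    rw [ih (fun m hm => h m (List.mem_cons_of_mem _ hm))]
    simp [h a (by simp)]

lemma ctrOK_neutral_of_notMem (xs : List (Lit ν)) (t : ℕ → ν) (h4 : 4 ≤ xs.length) (v : ν)
    (h1 : ∀ m ∈ xs, m.1 ≠ v) (h2 : ∀ k, k < xs.length - 3 → t k ≠ v) (j : ℕ) :
    Neutral v (ctrOK xs t j) := by
  refine ctrOK_neutral xs t j v fun hj => occv_of_notMem _ _ fun m hm => ?_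
  rcases parityCtr_vars xs t h4 j hj m hm with h | ⟨k, hk, h⟩
  · exact h1 m h
  · rw [h]; exact h2 k hk

/-- The constraint containing position `p` of a list of length `m`. -/
def vert (m p : ℕ) : ℕ := min (p - 1) (m - 3)

lemma occv_three (v : ν) (a b c : Lit ν) :
    occv v [a, b, c] = xor (decide (a.1 = v)) (xor (decide (b.1 = v)) (decide (c.1 = v))) := by
  simp [occv]

lemma chain_t (xs : List (Lit ν)) (t : ℕ → ν) (h4 : 4 ≤ xs.length)
    (ht : ∀ m ∈ xs, ∀ k, m.1 ≠ t k) (tinj : Function.Injective t) (k : ℕ)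
    (hk : k + 3 < xs.length) (j : ℕ) (hj : j < xs.length - 2) :
    occv (t k) (parityCtr xs t j) = decide (j = k ∨ j = k + 1) := by
  have hX : ∀ p, p < xs.length → (xs.getD p (t 0, true)).1 ≠ t k := by
    intro p hp
    rw [List.getD_eq_getElem _ _ hp]; exact ht _ (List.getElem_mem hp) k
  unfold parityCtr
  have ti : ∀ a, (t a = t k) = (a = k) := fun a => by
    rw [eq_iff_iff]; exact tinj.eq_iff
  split_ifs with h1 h2
  · rw [occv_three]
    simp only [hX 0 (by omega), hX 1 (by omega), ti]
    subst h1
    by_cases h : 0 = k <;> simp [h]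
  · rw [occv_three]
    simp only [hX (j + 1) (by omega), ti]
    by_cases h : j = k
    · subst h
      have : ¬ (j - 1 = j) := by omega
      simp [this]
    · by_cases h' : j = k + 1
      · subst h'; simp
      · have : ¬ (j - 1 = k) := by omega
        simp [h, h', this]
  · rw [occv_three]
    simp only [hX (xs.length - 2) (by omega), hX (xs.length - 1) (by omega), ti]
    by_cases h : xs.length - 4 = k
    · have : j = k ∨ j = k + 1 := by omega
      simp [h, this]
    · have : ¬ (j = k ∨ j = k + 1) := by omega
      simp [h, this]

lemma chain_x (xs : List (Lit ν)) (t : ℕ → ν) (h4 : 4 ≤ xs.length)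
    (ht : ∀ m ∈ xs, ∀ k, m.1 ≠ t k) (hnd : (xs.map Prod.fst).Nodup) (p : ℕ)
    (hp : p < xs.length) (j : ℕ) (hj : j < xs.length - 2) :
    occv (xs[p]).1 (parityCtr xs t j) = decide (j = vert xs.length p) := by
  have hT : ∀ k, t k ≠ (xs[p]).1 := fun k => (ht _ (List.getElem_mem hp) k).symm
  have hX : ∀ q, q < xs.length → ((xs.getD q (t 0, true)).1 = (xs[p]).1) = (q = p) := by
    intro q hq
    rw [List.getD_eq_getElem _ _ hq, eq_iff_iff]
    constructor
    · intro h
      have := (List.Nodup.getElem_inj_iff hnd (i := q) (j := p) (hi := by simpa using hq)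
        (hj := by simpa using hp)).1 (by simpa using h)
      exact this
    · rintro rfl; rfl
  unfold parityCtr vert
  split_ifs with h1 h2
  · rw [occv_three]
    simp only [hX 0 (by omega), hX 1 (by omega), hT]
    subst h1
    by_cases h : 0 = p
    · subst h; simp
    · by_cases h' : 1 = p
      · subst h'; simp
      · have : ¬ (0 = min (p - 1) (xs.length - 3)) := by omega
        simp [h, h', this]
  · rw [occv_three]
    simp only [hX (j + 1) (by omega), hT]
    by_cases h : j + 1 = p
    · have : j = min (p - 1) (xs.length - 3) := by omega
      simp [h, ← this]
    · have : ¬ (j = min (p - 1) (xs.length - 3)) := by omega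
      simp [h, this]
  · rw [occv_three]
    simp only [hX (xs.length - 2) (by omega), hX (xs.length - 1) (by omega), hT]
    by_cases h : xs.length - 2 = p
    · have : j = min (p - 1) (xs.length - 3) := by omega
      have h3 : ¬ (xs.length - 1 = p) := by omega
      simp [h, ← this, h3]
    · by_cases h' : xs.length - 1 = p
      · have : j = min (p - 1) (xs.length - 3) := by omega
        simp [h, h', ← this]
      · have : ¬ (j = min (p - 1) (xs.length - 3)) := by omega
        simp [h, h', this]

lemma xorv_take_succ (τ : ν → Bool) (xs : List (Lit ν)) (p : ℕ) (hp : p < xs.length) (d : Lit ν) :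
    (τ (xs.getD p d).1 == (xs.getD p d).2) = xor (xorv τ (xs.take p)) (xorv τ (xs.take (p + 1))) := by
  rw [List.take_succ_eq_append_getElem hp, xorv_append, List.getD_eq_getElem _ _ hp]
  have : xorv τ [xs[p]] = (τ xs[p].1 == xs[p].2) := by simp [xorv]
  rw [this]
  generalize xorv τ (xs.take p) = x
  generalize (τ xs[p].1 == xs[p].2) = y
  revert x y; decide

lemma chain_sat (xs : List (Lit ν)) (t : ℕ → ν) (h4 : 4 ≤ xs.length) (τ : ν → Bool) (j0 : ℕ)
    (hτ : ∀ k, k < xs.length - 3 → τ (t k) = xor (xorv τ (xs.take (k + 2))) (decide (j0 ≤ k)))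
    (htot : xorv τ xs = decide (j0 ≤ xs.length - 3)) (j : ℕ) (hj0 : j ≠ j0) :
    ctrOK xs t j τ := by
  intro hj
  have e3 : ∀ a b c : Lit ν, xorv τ [a, b, c] =
      xor (τ a.1 == a.2) (xor (τ b.1 == b.2) (τ c.1 == c.2)) := by
    intro a b c; simp [xorv]
  unfold parityCtr
  split_ifs with h1 h2
  · rw [e3, xorv_take_succ τ xs 0 (by omega), xorv_take_succ τ xs 1 (by omega)]
    simp only [hτ 0 (by omega)]
    have : ¬ (j0 ≤ 0) := by omega
    simp only [this]
    have h0 : xorv τ (xs.take 0) = false := by simp [xorv]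
    rw [h0]
    generalize xorv τ (xs.take (0 + 1)) = x
    change xor (xor false x) (xor (xor x (xorv τ (xs.take (0 + 2))))
      (xor (xorv τ (xs.take (0 + 2))) (decide False) == true)) = false
    generalize xorv τ (xs.take (0 + 2)) = y
    revert x y; decide
  · rw [e3, xorv_take_succ τ xs (j + 1) (by omega)]
    obtain ⟨i, rfl⟩ : ∃ i, j = i + 1 := ⟨j - 1, by omega⟩
    simp only [hτ (i + 1) (by omega), Nat.add_sub_cancel, hτ i (by omega)]
    have : decide (j0 ≤ i) = decide (j0 ≤ i + 1) := by
      rw [decide_eq_decide]; omega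
    rw [this]
    have e : i + 1 + 1 = i + 2 := rfl
    have e' : i + 1 + 1 + 1 = i + 1 + 2 := rfl
    rw [e, e']
    generalize xorv τ (xs.take (i + 2)) = x
    generalize xorv τ (xs.take (i + 1 + 2)) = y
    generalize decide (j0 ≤ i + 1) = z
    revert x y z; decide
  · rw [e3, xorv_take_succ τ xs (xs.length - 2) (by omega),
      xorv_take_succ τ xs (xs.length - 1) (by omega)]
    simp only [hτ (xs.length - 4) (by omega)]
    have e1 : xs.length - 4 + 2 = xs.length - 2 := by omega
    have e2 : xs.length - 2 + 1 = xs.length - 1 := by omega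
    have e5 : xs.length - 1 + 1 = xs.length := by omega
    have : decide (j0 ≤ xs.length - 4) = decide (j0 ≤ xs.length - 3) := by
      rw [decide_eq_decide]; omega
    rw [e1, e2, e5, this, List.take_length, htot]
    generalize xorv τ (xs.take (xs.length - 2)) = x
    generalize xorv τ (xs.take (xs.length - 1)) = y
    generalize decide (j0 ≤ xs.length - 3) = z
    revert x y z; decide

end Chain

section Lists

/-- Number of elements of `A` among the first `q` values of `σ`. -/
def pcount {n : ℕ} (A : Finset (Fin n)) (σ : Equiv.Perm (Fin n)) (q : ℕ) : ℕ :=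
  ((List.ofFn (fun i => σ i)).take q).countP (fun i => decide (i ∈ A))

lemma filter_getElem_countP {α : Type} (P : α → Bool) (l : List α) (q : ℕ) (hq : q < l.length)
    (hP : P l[q] = true) :
    ∃ h : (l.take q).countP P < (l.filter P).length, (l.filter P)[(l.take q).countP P] = l[q] := by
  have hl : l.filter P = (l.take q).filter P ++ l[q] :: (l.drop (q + 1)).filter P := by
    conv_lhs => rw [← List.take_append_drop q l, List.drop_eq_getElem_cons hq]
    rw [List.filter_append, List.filter_cons_of_pos hP]
  have hc : (l.take q).countP P = ((l.take q).filter P).length := List.countP_eq_length_filter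
  refine ⟨by rw [hl, hc]; simp, ?_⟩
  simp only [hl, hc]
  simp

lemma orderedElems_nodup {n : ℕ} (A : Finset (Fin n)) (σ : Equiv.Perm (Fin n)) :
    (orderedElems A σ).Nodup := by
  unfold orderedElems
  exact List.Nodup.filter _ (List.nodup_ofFn.2 σ.injective)

lemma mem_orderedElems {n : ℕ} (A : Finset (Fin n)) (σ : Equiv.Perm (Fin n)) (i : Fin n) :
    i ∈ orderedElems A σ ↔ i ∈ A := by
  simp only [orderedElems, List.mem_filter, List.mem_ofFn, decide_eq_true_eq]
  constructor
  · exact fun h => h.2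
  · exact fun h => ⟨⟨σ.symm i, by simp⟩, h⟩

lemma orderedElems_length {n : ℕ} (A : Finset (Fin n)) (σ : Equiv.Perm (Fin n)) :
    (orderedElems A σ).length = A.card := by
  rw [← List.toFinset_card_of_nodup (orderedElems_nodup A σ)]
  congr 1
  ext i
  simp [mem_orderedElems]

lemma pcount_succ {n : ℕ} (A : Finset (Fin n)) (σ : Equiv.Perm (Fin n)) (q : Fin n) :
    pcount A σ (q + 1) = pcount A σ q + if σ q ∈ A then 1 else 0 := by
  unfold pcount
  rw [List.take_succ_eq_append_getElem (by simp), List.countP_append]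
  congr 1
  simp [List.countP_singleton]

lemma pcount_mono {n : ℕ} (A : Finset (Fin n)) (σ : Equiv.Perm (Fin n)) :
    Monotone (pcount A σ) := by
  intro a b hab
  unfold pcount
  exact List.Sublist.countP_le (List.take_sublist_take_left hab)

lemma orderedElems_pcount {n : ℕ} (A : Finset (Fin n)) (σ : Equiv.Perm (Fin n)) (q : Fin n)
    (hq : σ q ∈ A) :
    ∃ h : pcount A σ q < (orderedElems A σ).length, (orderedElems A σ)[pcount A σ q] = σ q := by
  have := filter_getElem_countP (fun i => decide (i ∈ A)) (List.ofFn (fun i => σ i)) q (by simp)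
    (by simpa using hq)
  simpa [pcount, orderedElems] using this

lemma pcount_inj {n : ℕ} (A : Finset (Fin n)) (σ : Equiv.Perm (Fin n)) (q q' : Fin n)
    (hq : σ q ∈ A) (hq' : σ q' ∈ A) (h : pcount A σ q = pcount A σ q') : q = q' := by
  obtain ⟨h1, h2⟩ := orderedElems_pcount A σ q hq
  obtain ⟨h1', h2'⟩ := orderedElems_pcount A σ q' hq'
  apply σ.injective
  rw [← h2, ← h2']
  congr 1

/-- Positions where the membership in `S` changes. -/
noncomputable def dF {n : ℕ} (S : Finset (Fin n)) : Finset (Fin n) :=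
  open Classical in Finset.univ.filter
    (fun q => ¬ (q ∈ S ↔ ∃ q' : Fin n, q'.val + 1 = q.val ∧ q' ∈ S))

/-- Positions induced by a set of constraints of a chain. -/
noncomputable def posSet {n : ℕ} (A : Finset (Fin n)) (σ : Equiv.Perm (Fin n)) (S : Finset ℕ) :
    Finset (Fin n) :=
  Finset.univ.filter (fun q => vert A.card (pcount A σ q) ∈ S)

/-- Boundary edges within a chain. -/
def chainBd (m : ℕ) (S : Finset ℕ) : Finset ℕ :=
  (Finset.range (m - 3)).filter (fun k => ¬ (k ∈ S ↔ k + 1 ∈ S))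

lemma vert_mono (m : ℕ) : Monotone (vert m) := by
  intro a b hab
  unfold vert
  omega

lemma dF_posSet_card {n : ℕ} (A : Finset (Fin n)) (σ : Equiv.Perm (Fin n)) (S : Finset ℕ) :
    (dF (posSet A σ S)).card ≤ (chainBd A.card S).card + 1 := by
  classical
  have key : ∀ q ∈ dF (posSet A σ S), q.val ≠ 0 →
      vert A.card (pcount A σ (q.val - 1)) ∈ chainBd A.card S ∧
      vert A.card (pcount A σ q) = vert A.card (pcount A σ (q.val - 1)) + 1 := by
    intro q hq hq0
    simp only [dF, posSet, Finset.mem_filter, Finset.mem_univ, true_and] at hq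
    set q' : Fin n := ⟨q.val - 1, by omega⟩ with hq'
    have hq1 : q'.val + 1 = q.val := by simp [hq']; omega
    have hex : (∃ r : Fin n, r.val + 1 = q.val ∧ vert A.card (pcount A σ r) ∈ S)
        ↔ vert A.card (pcount A σ q') ∈ S := by
      constructor
      · rintro ⟨r, hr, hrS⟩
        have : r = q' := Fin.ext (by omega)
        rwa [this] at hrS
      · intro h; exact ⟨q', hq1, h⟩
    rw [hex] at hq
    have hp := pcount_succ A σ q'
    rw [hq1] at hp
    have hne : vert A.card (pcount A σ q) ≠ vert A.card (pcount A σ q') := by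
      intro h; rw [h] at hq; exact hq Iff.rfl
    have hs : vert A.card (pcount A σ q) = vert A.card (pcount A σ q') + 1 := by
      unfold vert at hne ⊢
      split_ifs at hp <;> omega
    refine ⟨?_, hs⟩
    change vert A.card (pcount A σ q') ∈ _
    simp only [chainBd, Finset.mem_filter, Finset.mem_range]
    refine ⟨?_, ?_⟩
    · have : vert A.card (pcount A σ q) ≤ A.card - 3 := by unfold vert; omega
      omega
    · rw [← hs]; tauto
  have h1 : ((dF (posSet A σ S)).filter (fun q => q.val ≠ 0)).card ≤ (chainBd A.card S).card := by
    refine Finset.card_le_card_of_injOn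
      (fun q => vert A.card (pcount A σ (q.val - 1))) ?_ ?_
    · intro q hq
      have hq := Finset.mem_filter.1 hq
      exact (key q hq.1 hq.2).1
    · have aux : ∀ q q' : Fin n, q ∈ dF (posSet A σ S) → q.val ≠ 0 → q < q' →
          vert A.card (pcount A σ (q.val - 1)) < vert A.card (pcount A σ (q'.val - 1)) := by
        intro q q' hq hq0 hlt
        have h := (key q hq hq0).2
        have hlt' : q.val < q'.val := hlt
        have := vert_mono A.card (pcount_mono A σ (show q.val ≤ q'.val - 1 by omega))
        omega
      intro q hq q' hq' heq
      have hq := Finset.mem_filter.1 hq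
      have hq' := Finset.mem_filter.1 hq'
      simp only at heq
      rcases lt_trichotomy q q' with h | h | h
      · have := aux q q' hq.1 hq.2 h; omega
      · exact h
      · have := aux q' q hq'.1 hq'.2 h; omega
  have h2 : ((dF (posSet A σ S)).filter (fun q => ¬ q.val ≠ 0)).card ≤ 1 := by
    rw [Finset.card_le_one]
    intro a ha b hb
    have ha := (Finset.mem_filter.1 ha).2
    have hb := (Finset.mem_filter.1 hb).2
    exact Fin.ext (by omega)
  have h3 := Finset.card_filter_add_card_filter_not (s := dF (posSet A σ S)) (fun q => q.val ≠ 0)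
  omega

end Lists

section Deterministic

/-- The assignment setting exactly one variable to true. -/
def oneVar (i : ℕ) : ℕ → Bool := fun v => decide (v = i)

lemma xorv_congr (τ τ' : ν → Bool) (ls : List (Lit ν)) (h : ∀ m ∈ ls, τ m.1 = τ' m.1) :
    xorv τ ls = xorv τ' ls := by
  unfold xorv
  congr 1
  apply List.map_congr_left
  intro m hm
  rw [h m hm]

lemma foldr_xor_decide {α : Type} [DecidableEq α] (l : List α) (hl : l.Nodup) (a : α) :
    (l.map (fun i => decide (i = a))).foldr xor false = decide (a ∈ l) := by
  induction l with
  | nil => simp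
  | cons b l ih =>
    rw [List.nodup_cons] at hl
    rw [List.map_cons, List.foldr_cons, ih hl.2]
    by_cases h : b = a
    · subst h; simp [hl.1]
    · have h' : ¬ a = b := fun e => h e.symm
      simp [h, h']

lemma foldr_xor_xor {α : Type} (l : List α) (f g : α → Bool) :
    (l.map (fun i => xor (f i) (g i))).foldr xor false =
      xor ((l.map f).foldr xor false) ((l.map g).foldr xor false) := by
  induction l with
  | nil => simp
  | cons b l ih =>
    simp only [List.map_cons, List.foldr_cons, ih]
    generalize f b = x
    generalize g b = y
    generalize List.foldr xor false (List.map f l) = z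
    generalize List.foldr xor false (List.map g l) = u
    revert x y z u; decide

lemma posLits_eq {n : ℕ} (l : List (Fin n)) :
    posLits l = l.map (fun i => ((i : Fin n).val, true)) := by
  unfold posLits
  induction l with
  | nil => rfl
  | cons a l ih => simpa using ih

lemma xorv_posLits {n : ℕ} (A : Finset (Fin n)) (σ : Equiv.Perm (Fin n)) (i0 : Fin n) :
    xorv (oneVar i0) (posLits (orderedElems A σ)) = decide (i0 ∈ A) := by
  have h := foldr_xor_decide _ (orderedElems_nodup A σ) i0
  simp only [mem_orderedElems] at h
  rw [← h]
  rw [posLits_eq]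
  unfold xorv oneVar
  rw [List.map_map]
  congr 1
  apply List.map_congr_left
  intro i _
  simp [Fin.ext_iff]

lemma xorv_symmLits {n : ℕ} (A B : Finset (Fin n)) (σ : Equiv.Perm (Fin n)) (i0 : Fin n)
    (hi : i0 ∈ symmDiff A B) :
    xorv (oneVar i0) (symmLits A B σ) = false := by
  obtain ⟨mx, hmx⟩ := Finset.max_of_mem hi
  have hmem := Finset.mem_of_max hmx
  have h1 := foldr_xor_decide _ (orderedElems_nodup (symmDiff A B) σ) i0
  have h2 := foldr_xor_decide _ (orderedElems_nodup (symmDiff A B) σ) mx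
  have h3 := foldr_xor_xor (orderedElems (symmDiff A B) σ) (fun i => decide (i = i0))
    (fun i => decide (i = mx))
  rw [h1, h2] at h3
  simp only [mem_orderedElems, hi, hmem, decide_true, Bool.xor_self] at h3
  rw [← h3]
  unfold xorv symmLits oneVar
  rw [List.map_map]
  congr 1
  apply List.map_congr_left
  intro i _
  rw [hmx]
  have e1 : ((i : ℕ) = (i0 : ℕ)) ↔ i = i0 := Fin.ext_iff.symm
  have e2 : ((i : WithBot (Fin n)) ≠ (mx : WithBot (Fin n))) ↔ ¬ i = mx := by
    rw [ne_eq, WithBot.coe_inj]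
  simp only [Function.comp, e1, e2]
  by_cases ha : i = i0 <;> by_cases hb : i = mx <;> simp [ha, hb]

lemma mem_posLits {n : ℕ} (A : Finset (Fin n)) (σ : Equiv.Perm (Fin n)) (m : Lit ℕ)
    (hm : m ∈ posLits (orderedElems A σ)) : ∃ i ∈ A, m.1 = (i : ℕ) := by
  simp only [posLits_eq, List.mem_map] at hm
  obtain ⟨i, hi, rfl⟩ := hm
  exact ⟨i, (mem_orderedElems A σ i).1 hi, rfl⟩

lemma mem_symmLits {n : ℕ} (A B : Finset (Fin n)) (σ : Equiv.Perm (Fin n)) (m : Lit ℕ)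
    (hm : m ∈ symmLits A B σ) : ∃ i ∈ symmDiff A B, m.1 = (i : ℕ) := by
  simp only [symmLits, List.mem_map] at hm
  obtain ⟨i, hi, rfl⟩ := hm
  exact ⟨i, (mem_orderedElems _ σ i).1 hi, rfl⟩

lemma posLits_length {n : ℕ} (A : Finset (Fin n)) (σ : Equiv.Perm (Fin n)) :
    (posLits (orderedElems A σ)).length = A.card := by
  simp [posLits_eq, orderedElems_length]

lemma symmLits_length {n : ℕ} (A B : Finset (Fin n)) (σ : Equiv.Perm (Fin n)) :
    (symmLits A B σ).length = (symmDiff A B).card := by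
  simp [symmLits, orderedElems_length]

lemma posLits_nodup {n : ℕ} (A : Finset (Fin n)) (σ : Equiv.Perm (Fin n)) :
    ((posLits (orderedElems A σ)).map Prod.fst).Nodup := by
  rw [posLits_eq, List.map_map]
  exact (orderedElems_nodup A σ).map Fin.val_injective

/-- The constraint of the chain over `A` that contains element `i`. -/
def vtx {n : ℕ} (A : Finset (Fin n)) (σ : Equiv.Perm (Fin n)) (i : Fin n) : ℕ :=
  vert A.card (pcount A σ (σ.symm i))

lemma vtx_lt {n : ℕ} (A : Finset (Fin n)) (σ : Equiv.Perm (Fin n)) (h4 : 4 ≤ A.card) (i : Fin n) :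
    vtx A σ i < A.card - 2 := by
  unfold vtx vert
  omega

/-- Chain over `A` with positive literals and Tseitin variables `c + k`, `c ≥ n`. -/
lemma chain_elem {n : ℕ} (A : Finset (Fin n)) (σ : Equiv.Perm (Fin n)) (h4 : 4 ≤ A.card)
    (c : ℕ) (hc : n ≤ c) (i : Fin n) (hi : i ∈ A) :
    Toggles (i : ℕ) (ctrOK (posLits (orderedElems A σ)) (fun k => c + k) (vtx A σ i)) ∧
    ∀ j, j ≠ vtx A σ i →
      Neutral (i : ℕ) (ctrOK (posLits (orderedElems A σ)) (fun k => c + k) j) := by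
  obtain ⟨h1, h2⟩ := orderedElems_pcount A σ (σ.symm i) (by simpa using hi)
  have hlen := posLits_length A σ
  have hl' := orderedElems_length A σ
  have hp : pcount A σ (σ.symm i) < (posLits (orderedElems A σ)).length := by omega
  have hx : ((posLits (orderedElems A σ))[pcount A σ (σ.symm i)]).1 = (i : ℕ) := by
    simp only [posLits_eq, List.getElem_map, h2, Equiv.apply_symm_apply]
  have ht : ∀ m ∈ posLits (orderedElems A σ), ∀ k, m.1 ≠ c + k := by
    intro m hm k
    obtain ⟨i, -, h⟩ := mem_posLits A σ m hm
    omega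
  have key := chain_x (posLits (orderedElems A σ)) (fun k => c + k) (by omega) ht
    (posLits_nodup A σ) _ hp
  rw [hx] at key
  constructor
  · refine ctrOK_toggles _ _ _ _ (by rw [hlen]; exact vtx_lt A σ h4 i) ?_
    rw [key _ (by rw [hlen]; exact vtx_lt A σ h4 i)]
    simp [vtx, hlen]
  · intro j hj
    refine ctrOK_neutral _ _ _ _ fun hj' => ?_
    rw [key _ hj']
    simp only [decide_eq_false_iff_not]
    rw [hlen]; exact hj

lemma chain_tseitin {n : ℕ} (A : Finset (Fin n)) (σ : Equiv.Perm (Fin n)) (h4 : 4 ≤ A.card)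
    (c : ℕ) (hc : n ≤ c) (k : ℕ) (hk : k < A.card - 3) (j : ℕ) :
    ((j = k ∨ j = k + 1) →
      Toggles (c + k) (ctrOK (posLits (orderedElems A σ)) (fun k => c + k) j)) ∧
    (¬ (j = k ∨ j = k + 1) →
      Neutral (c + k) (ctrOK (posLits (orderedElems A σ)) (fun k => c + k) j)) := by
  have hlen := posLits_length A σ
  have ht : ∀ m ∈ posLits (orderedElems A σ), ∀ k, m.1 ≠ c + k := by
    intro m hm k
    obtain ⟨i, -, h⟩ := mem_posLits A σ m hm
    omega
  have key := chain_t (posLits (orderedElems A σ)) (fun k => c + k) (by omega) ht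
    (fun a b h => by simpa using h) k (by omega) j
  constructor
  · intro hj
    refine ctrOK_toggles _ _ _ _ (by omega) ?_
    rw [key (by omega)]; simpa using hj
  · intro hj
    refine ctrOK_neutral _ _ _ _ fun hj' => ?_
    rw [key hj']; simpa using hj

lemma chain_other {n : ℕ} (A : Finset (Fin n)) (σ : Equiv.Perm (Fin n)) (h4 : 4 ≤ A.card)
    (c : ℕ) (v : ℕ) (hv : n ≤ v) (hvc : v < c ∨ c + n ≤ v) (j : ℕ) :
    Neutral v (ctrOK (posLits (orderedElems A σ)) (fun k => c + k) j) := by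
  have hlen := posLits_length A σ
  have hA : A.card ≤ n := by simpa using Finset.card_le_univ A
  refine ctrOK_neutral_of_notMem _ _ (by omega) v ?_ ?_ j
  · intro m hm
    obtain ⟨i, -, h⟩ := mem_posLits A σ m hm
    omega
  · intro k hk
    omega

lemma symm_other {n : ℕ} (A B : Finset (Fin n)) (σ : Equiv.Perm (Fin n))
    (h4 : 4 ≤ (symmDiff A B).card) (v : ℕ) (hv : ∀ i ∈ symmDiff A B, v ≠ (i : ℕ))
    (hvc : v < 3 * n) (j : ℕ) :
    Neutral v (ctrOK (symmLits A B σ) (fun k => 3 * n + k) j) := by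
  have hlen := symmLits_length A B σ
  refine ctrOK_neutral_of_notMem _ _ (by omega) v ?_ ?_ j
  · intro m hm
    obtain ⟨i, hi, h⟩ := mem_symmLits A B σ m hm
    rw [h]; exact (hv i hi).symm
  · intro k hk
    omega

/-- Satisfiability with one constraint of the first chain removed. -/
lemma local_sat {n : ℕ} (A B : Finset (Fin n)) (σa σb σc : Equiv.Perm (Fin n))
    (hA : 4 ≤ A.card) (hB : 4 ≤ B.card) (hC : 4 ≤ (symmDiff A B).card)
    (i0 : Fin n) (hi0 : i0 ∈ A) (hi0' : i0 ∉ B) (j0 : ℕ) (hj0 : j0 ≤ A.card - 3) :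
    ∃ τ : ℕ → Bool, (∀ j, ctrOK (symmLits A B σc) (fun k => 3 * n + k) j τ) ∧
      (∀ j, j ≠ j0 → ctrOK (posLits (orderedElems A σa)) (fun k => n + k) j τ) ∧
      (∀ j, ctrOK (posLits (orderedElems B σb)) (fun k => 2 * n + k) j τ) := by
  set xa := posLits (orderedElems A σa) with hxa
  set xb := posLits (orderedElems B σb) with hxb
  set xc := symmLits A B σc with hxc
  have hla : xa.length = A.card := posLits_length A σa
  have hlb : xb.length = B.card := posLits_length B σb
  have hlc : xc.length = (symmDiff A B).card := symmLits_length A B σc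
  have hAn : A.card ≤ n := by simpa using Finset.card_le_univ A
  have hBn : B.card ≤ n := by simpa using Finset.card_le_univ B
  have hCn : (symmDiff A B).card ≤ n := by simpa using Finset.card_le_univ (symmDiff A B)
  have hi0C : i0 ∈ symmDiff A B := by rw [Finset.mem_symmDiff]; exact Or.inl ⟨hi0, hi0'⟩
  set τ : ℕ → Bool := fun v =>
    if v < n then oneVar i0 v
    else if v < 2 * n then
      xor (xorv (oneVar i0) (xa.take (v - n + 2))) (decide (j0 ≤ v - n))
    else if v < 3 * n then xorv (oneVar i0) (xb.take (v - 2 * n + 2))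
    else xorv (oneVar i0) (xc.take (v - 3 * n + 2)) with hτ
  have hcong : ∀ ls : List (Lit ℕ), (∀ m ∈ ls, m.1 < n) → xorv τ ls = xorv (oneVar i0) ls := by
    intro ls h
    apply xorv_congr
    intro m hm
    simp [hτ, h m hm]
  have hva : ∀ m ∈ xa, m.1 < n := by
    intro m hm
    obtain ⟨i, -, h⟩ := mem_posLits A σa m hm
    omega
  have hvb : ∀ m ∈ xb, m.1 < n := by
    intro m hm
    obtain ⟨i, -, h⟩ := mem_posLits B σb m hm
    omega
  have hvc : ∀ m ∈ xc, m.1 < n := by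
    intro m hm
    obtain ⟨i, -, h⟩ := mem_symmLits A B σc m hm
    omega
  refine ⟨τ, ?_, ?_, ?_⟩
  · intro j
    by_cases hj : j < xc.length - 2
    swap
    · intro h; exact absurd h hj
    refine chain_sat xc _ (by omega) τ (xc.length) ?_ ?_ j (by omega)
    · intro k hk
      rw [hcong _ (fun m hm => hvc m (List.mem_of_mem_take hm))]
      have h1 : ¬ (3 * n + k < n) := by omega
      have h2 : ¬ (3 * n + k < 2 * n) := by omega
      have h3 : ¬ (3 * n + k < 3 * n) := by omega
      have h4 : 3 * n + k - 3 * n = k := by omega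
      have h5 : ¬ (xc.length ≤ k) := by omega
      simp only [hτ, h1, h2, h3, h4, h5, if_false, decide_false, Bool.xor_false]
    · rw [hcong _ hvc, xorv_symmLits A B σc i0 hi0C]
      have : ¬ (xc.length ≤ xc.length - 3) := by omega
      simp [this]
  · intro j hj
    refine chain_sat xa _ (by omega) τ j0 ?_ ?_ j hj
    · intro k hk
      rw [hcong _ (fun m hm => hva m (List.mem_of_mem_take hm))]
      have h1 : ¬ (n + k < n) := by omega
      have h2 : n + k < 2 * n := by omega
      have h4 : n + k - n = k := by omega
      simp only [hτ, h1, h2, h4, if_false, if_true]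
    · rw [hcong _ hva, xorv_posLits A σa i0, hla]
      simp [hi0, hj0]
  · intro j
    by_cases hj : j < xb.length - 2
    swap
    · intro h; exact absurd h hj
    refine chain_sat xb _ (by omega) τ (xb.length) ?_ ?_ j (by omega)
    · intro k hk
      rw [hcong _ (fun m hm => hvb m (List.mem_of_mem_take hm))]
      have h1 : ¬ (2 * n + k < n) := by omega
      have h2 : ¬ (2 * n + k < 2 * n) := by omega
      have h3 : (2 * n + k < 3 * n) := by omega
      have h4 : 2 * n + k - 2 * n = k := by omega
      have h5 : ¬ (xb.length ≤ k) := by omega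
      simp only [hτ, h1, h2, h3, h4, h5, if_false, if_true, decide_false, Bool.xor_false]
    · rw [hcong _ hvb, xorv_posLits B σb i0]
      have : ¬ (xb.length ≤ xb.length - 3) := by omega
      simp [this, hi0']

/-- The combinatorial expansion property, negated: a balanced cut with few cut edges. -/
def BadCut {n : ℕ} (w T : ℕ) (A B : Finset (Fin n)) (σa σb : Equiv.Perm (Fin n)) : Prop :=
  ∃ F G : Finset (Fin n), (dF F).card ≤ w ∧ (dF G).card ≤ w ∧
    ((symmDiff (F.image σa) (G.image σb)) ∩ (A ∩ B)).card ≤ w ∧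
    T < (F.image σa ∩ (A ∩ B)).card ∧ (F.image σa ∩ (A ∩ B)).card ≤ 2 * T

lemma mem_posSet_image {n : ℕ} (A : Finset (Fin n)) (σ : Equiv.Perm (Fin n)) (S : Finset ℕ)
    (i : Fin n) : i ∈ (posSet A σ S).image σ ↔ vtx A σ i ∈ S := by
  simp only [posSet, Finset.mem_image, Finset.mem_filter, Finset.mem_univ, true_and, vtx]
  constructor
  · rintro ⟨q, hq, rfl⟩; simpa using hq
  · intro h; exact ⟨σ.symm i, h, by simp⟩

theorem det_bound {n : ℕ} (A B : Finset (Fin n)) (σa σb σc : Equiv.Perm (Fin n))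
    (w k d T : ℕ) (hA : 4 ≤ A.card) (hB : 4 ≤ B.card) (hC : 4 ≤ (symmDiff A B).card)
    (i0 : Fin n) (hi0 : i0 ∈ A) (hi0' : i0 ∉ B) (hT3 : 3 ≤ T) (hT : T < (A ∩ B).card)
    (hcut : ¬ BadCut w T A B σa σb) (hkd : k + d + 3 ≤ w) (hd : d ≤ 8 * n)
    (L : List (Clause ℕ)) (hL : IsResRefutation (rAddPar n A B σa σb σc) L) :
    1 ≤ (1 - (d : ℝ) / (8 * n : ℕ)) ^ k * L.length := by
  classical
  have hAn : A.card ≤ n := by simpa using Finset.card_le_univ A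
  have hBn : B.card ≤ n := by simpa using Finset.card_le_univ B
  have hCn : (symmDiff A B).card ≤ n := by simpa using Finset.card_le_univ (symmDiff A B)
  set V : Finset (Lit ℕ) := Finset.range (4 * n) ×ˢ Finset.univ with hVdef
  have hVc : V.card = 8 * n := by
    rw [hVdef, Finset.card_product]; simp; ring
  rw [← hVc]
  set sat : ℕ ⊕ ℕ → (ℕ → Bool) → Prop := Sum.elim
    (fun j => ctrOK (posLits (orderedElems A σa)) (fun k => n + k) j)
    (fun j => ctrOK (posLits (orderedElems B σb)) (fun k => 2 * n + k) j) with hsatdef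
  set base : (ℕ → Bool) → Prop := fun τ =>
    ∀ j, ctrOK (symmLits A B σc) (fun k => 3 * n + k) j τ with hbase
  set wt : Finset (ℕ ⊕ ℕ) → ℕ := fun S =>
    ((A ∩ B).filter (fun i => Sum.inl (vtx A σa i) ∈ S)).card with hwt
  refine expansion_size (rAddPar n A B σa σb σc) w k d T V base sat wt ?_ ?_ ?_ ?_ ?_ ?_ ?_ ?_
    hkd (by omega) (by omega) ?_ L hL
  · intro S S' h
    refine Finset.card_le_card ?_
    intro i hi
    rw [Finset.mem_filter] at hi ⊢
    exact ⟨hi.1, h hi.2⟩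
  · intro S S'
    refine (Finset.card_le_card ?_).trans (Finset.card_union_le _ _)
    intro i hi
    simp only [Finset.mem_filter, Finset.mem_union] at hi ⊢
    tauto
  · simp [hwt]
  · intro u
    rcases u with u | u
    · refine le_trans ?_ hT3
      have : wt {Sum.inl u} ≤ ({u, u + 1, u + 2} : Finset ℕ).card := by
        refine Finset.card_le_card_of_injOn (fun i => pcount A σa (σa.symm i)) ?_ ?_
        · intro i hi
          have hi := Finset.mem_filter.1 hi
          have h1 : vtx A σa i = u := by simpa using hi.2
          obtain ⟨h2, -⟩ := orderedElems_pcount A σa (σa.symm i)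
            (by simpa using (Finset.mem_inter.1 hi.1).1)
          rw [orderedElems_length] at h2
          unfold vtx vert at h1
          simp only [Finset.coe_insert, Finset.coe_singleton, Set.mem_insert_iff,
            Set.mem_singleton_iff]
          omega
        · intro i hi i' hi' h
          have hi := (Finset.mem_inter.1 (Finset.mem_filter.1 hi).1).1
          have hi' := (Finset.mem_inter.1 (Finset.mem_filter.1 hi').1).1
          exact σa.symm.injective (pcount_inj A σa _ _ (by simpa using hi) (by simpa using hi') h)
      exact this.trans Finset.card_le_three
    · simp [hwt]
  · intro C hCF
    simp only [rAddPar, Finset.mem_union] at hCF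
    rcases hCF with (h | h) | h
    · obtain ⟨j, hj⟩ := ctrOK_sound _ _ C h
      exact Or.inr ⟨Sum.inl j, hj⟩
    · obtain ⟨j, hj⟩ := ctrOK_sound _ _ C h
      exact Or.inr ⟨Sum.inr j, hj⟩
    · obtain ⟨j, hj⟩ := ctrOK_sound _ _ C h
      exact Or.inl fun τ hτ => hj τ (hτ j)
  · intro S hS
    have : ∃ i ∈ A ∩ B, Sum.inl (vtx A σa i) ∉ S := by
      by_contra hcon
      push Not at hcon
      have : wt S = (A ∩ B).card := by
        simp only [hwt]; rw [Finset.filter_true_of_mem hcon]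
      omega
    obtain ⟨i, hi, hiS⟩ := this
    obtain ⟨τ, h1, h2, h3⟩ := local_sat A B σa σb σc hA hB hC i0 hi0 hi0' (vtx A σa i)
      (by have := vtx_lt A σa hA i; omega)
    refine ⟨τ, h1, ?_⟩
    rintro (u | u) hu
    · refine h2 u ?_
      rintro rfl
      exact hiS hu
    · exact h3 u
  · intro S hS1 hS2
    set E1 := (chainBd A.card S.toLeft).image (fun k => n + k) with hE1
    set E2 := (chainBd B.card S.toRight).image (fun k => 2 * n + k) with hE2
    set M := (symmDiff ((posSet A σa S.toLeft).image σa) ((posSet B σb S.toRight).image σb))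
      ∩ (A ∩ B) with hM
    set E3 := M.image (fun i : Fin n => (i : ℕ)) with hE3
    refine ⟨E1 ∪ E2 ∪ E3, ?_, ?_⟩
    · by_contra hlt
      apply hcut
      have c1 : E1.card ≤ (E1 ∪ E2 ∪ E3).card := Finset.card_le_card (by
        intro x hx; simp [hx])
      have c2 : E2.card ≤ (E1 ∪ E2 ∪ E3).card := Finset.card_le_card (by
        intro x hx; simp [hx])
      have c3 : E3.card ≤ (E1 ∪ E2 ∪ E3).card := Finset.card_le_card (by
        intro x hx; simp [hx])
      have e1 : E1.card = (chainBd A.card S.toLeft).card :=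
        Finset.card_image_of_injective _ (add_right_injective n)
      have e2 : E2.card = (chainBd B.card S.toRight).card :=
        Finset.card_image_of_injective _ (add_right_injective (2 * n))
      have e3 : E3.card = M.card := Finset.card_image_of_injective _ Fin.val_injective
      have d1 := dF_posSet_card A σa S.toLeft
      have d2 := dF_posSet_card B σb S.toRight
      have hw : wt S = ((posSet A σa S.toLeft).image σa ∩ (A ∩ B)).card := by
        simp only [hwt]
        congr 1
        ext i
        simp only [Finset.mem_filter, Finset.mem_inter, mem_posSet_image, Finset.mem_toLeft]
        tauto
      refine ⟨posSet A σa S.toLeft, posSet B σb S.toRight, by omega, by omega, ?_,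
        by omega, by omega⟩
      have hMw : M.card ≤ w := by omega
      exact hMw
    · intro v hv
      simp only [Finset.mem_union] at hv
      rcases hv with (hv | hv) | hv
      · obtain ⟨k, hk, rfl⟩ := Finset.mem_image.1 hv
        simp only [chainBd, Finset.mem_filter, Finset.mem_range, Finset.mem_toLeft] at hk
        obtain ⟨hk1, hk2⟩ := hk
        have hneuB : ∀ j, Neutral (n + k) (sat (Sum.inr j)) := fun j =>
          chain_other B σb hB (2 * n) (n + k) (by omega) (by omega) j
        refine ⟨?_, ?_⟩
        · intro τ
          refine forall_congr' fun j => ?_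
          exact symm_other A B σc hC (n + k) (fun i _ => by omega) (by omega) j τ
        · have ht := chain_tseitin A σa hA n le_rfl k hk1
          by_cases hkS : Sum.inl k ∈ S
          · have hk' : Sum.inl (k + 1) ∉ S := by tauto
            refine ⟨Sum.inl k, hkS, (ht k).1 (Or.inl rfl), ?_⟩
            rintro (u | u) hu hne
            · refine (ht u).2 ?_
              rintro (rfl | rfl)
              · exact hne rfl
              · exact hk' hu
            · exact hneuB u
          · have hk' : Sum.inl (k + 1) ∈ S := by tauto
            refine ⟨Sum.inl (k + 1), hk', (ht (k + 1)).1 (Or.inr rfl), ?_⟩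
            rintro (u | u) hu hne
            · refine (ht u).2 ?_
              rintro (rfl | rfl)
              · exact hkS hu
              · exact hne rfl
            · exact hneuB u
      · obtain ⟨k, hk, rfl⟩ := Finset.mem_image.1 hv
        simp only [chainBd, Finset.mem_filter, Finset.mem_range, Finset.mem_toRight] at hk
        obtain ⟨hk1, hk2⟩ := hk
        have hneuA : ∀ j, Neutral (2 * n + k) (sat (Sum.inl j)) := fun j =>
          chain_other A σa hA n (2 * n + k) (by omega) (by omega) j
        refine ⟨?_, ?_⟩
        · intro τ
          refine forall_congr' fun j => ?_
          exact symm_other A B σc hC (2 * n + k) (fun i _ => by omega) (by omega) j τ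
        · have ht := chain_tseitin B σb hB (2 * n) (by omega) k hk1
          by_cases hkS : Sum.inr k ∈ S
          · have hk' : Sum.inr (k + 1) ∉ S := by tauto
            refine ⟨Sum.inr k, hkS, (ht k).1 (Or.inl rfl), ?_⟩
            rintro (u | u) hu hne
            · exact hneuA u
            · refine (ht u).2 ?_
              rintro (rfl | rfl)
              · exact hne rfl
              · exact hk' hu
          · have hk' : Sum.inr (k + 1) ∈ S := by tauto
            refine ⟨Sum.inr (k + 1), hk', (ht (k + 1)).1 (Or.inr rfl), ?_⟩
            rintro (u | u) hu hne
            · exact hneuA u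
            · refine (ht u).2 ?_
              rintro (rfl | rfl)
              · exact hkS hu
              · exact hne rfl
      · obtain ⟨i, hi, rfl⟩ := Finset.mem_image.1 hv
        rw [hM, Finset.mem_inter, Finset.mem_inter, Finset.mem_symmDiff, mem_posSet_image,
          mem_posSet_image, Finset.mem_toLeft, Finset.mem_toRight] at hi
        obtain ⟨hxor, hiA, hiB⟩ := hi
        have ha := chain_elem A σa hA n le_rfl i hiA
        have hb := chain_elem B σb hB (2 * n) (by omega) i hiB
        refine ⟨?_, ?_⟩
        · intro τ
          refine forall_congr' fun j => ?_
          refine symm_other A B σc hC i (fun i' hi' => ?_) (by omega) j τ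
          intro heq
          have : i = i' := Fin.ext heq
          subst this
          rw [Finset.mem_symmDiff] at hi'
          tauto
        · rcases hxor with ⟨h1, h2⟩ | ⟨h1, h2⟩
          · refine ⟨_, h1, ha.1, ?_⟩
            rintro (u | u) hu hne
            · exact ha.2 u (fun h => hne (by rw [h]))
            · refine hb.2 u ?_
              rintro rfl
              exact h2 hu
          · refine ⟨_, h1, hb.1, ?_⟩
            rintro (u | u) hu hne
            · refine ha.2 u ?_
              rintro rfl
              exact h2 hu
            · exact hb.2 u (fun h => hne (by rw [h]))
  · intro C hCF
    simp only [rAddPar, Finset.mem_union] at hCF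
    rcases hCF with (h | h) | h <;> exact ParityCNF_card _ _ C h
  · intro C hCF l hl
    have hlt : l.1 < 4 * n := by
      simp only [rAddPar, Finset.mem_union] at hCF
      rcases hCF with (h | h) | h
      · rcases ParityCNF_vars _ _ (by rw [posLits_length]; exact hA) C h l hl with
          ⟨m, hm, hml⟩ | ⟨k, hk, hkl⟩
        · obtain ⟨i, -, hi⟩ := mem_posLits A σa m hm
          omega
        · rw [posLits_length] at hk
          omega
      · rcases ParityCNF_vars _ _ (by rw [posLits_length]; exact hB) C h l hl with
          ⟨m, hm, hml⟩ | ⟨k, hk, hkl⟩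
        · obtain ⟨i, -, hi⟩ := mem_posLits B σb m hm
          omega
        · rw [posLits_length] at hk
          omega
      · rcases ParityCNF_vars _ _ (by rw [symmLits_length]; exact hC) C h l hl with
          ⟨m, hm, hml⟩ | ⟨k, hk, hkl⟩
        · obtain ⟨i, -, hi⟩ := mem_symmLits A B σc m hm
          omega
        · rw [symmLits_length] at hk
          omega
    simp [hVdef, hlt]

end Deterministic

section Counting

lemma sum_pow_inter {n : ℕ} (D : Finset (Fin n)) (z : ℝ) :
    ∑ A : Finset (Fin n), z ^ (D ∩ A).card = 2 ^ n * ((1 + z) / 2) ^ D.card := by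
  have h1 : ∀ A : Finset (Fin n), z ^ (D ∩ A).card = ∏ i ∈ A, (if i ∈ D then z else 1) := by
    intro A
    rw [Finset.prod_ite, Finset.prod_const_one, mul_one, Finset.prod_const,
      Finset.filter_mem_eq_inter, Finset.inter_comm]
  simp_rw [h1]
  have h2 := Finset.prod_one_add (Finset.univ : Finset (Fin n)) (f := fun i => if i ∈ D then z else 1)
  rw [Finset.powerset_univ] at h2
  rw [← h2]
  have h3 : ∀ i : Fin n, (1 + (if i ∈ D then z else 1) : ℝ) = 2 * (if i ∈ D then (1 + z) / 2 else 1) := by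
    intro i; split_ifs <;> ring
  simp_rw [h3]
  rw [Finset.prod_mul_distrib, Finset.prod_const, Finset.prod_ite, Finset.prod_const_one, mul_one,
    Finset.prod_const]
  simp

lemma sum_pow_inter_two {n : ℕ} (D : Finset (Fin n)) (z : ℝ) :
    ∑ p : Finset (Fin n) × Finset (Fin n), z ^ (D ∩ (p.1 ∩ p.2)).card =
      4 ^ n * ((3 + z) / 4) ^ D.card := by
  rw [Fintype.sum_prod_type]
  have : ∀ A : Finset (Fin n), ∑ B : Finset (Fin n), z ^ (D ∩ (A ∩ B)).card =
      2 ^ n * ((1 + z) / 2) ^ (D ∩ A).card := by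
    intro A
    rw [← sum_pow_inter]
    simp_rw [Finset.inter_assoc]
  simp only [this]
  rw [← Finset.mul_sum, sum_pow_inter, ← mul_assoc, ← mul_pow]
  norm_num
  congr 1
  ring

lemma card_le_sum_pow {ι : Type} [Fintype ι] (f : ι → ℕ) (k : ℕ) (z : ℝ) (hz : 0 < z)
    (hz1 : z ≤ 1) :
    ((Finset.univ.filter (fun i => f i ≤ k)).card : ℝ) * z ^ k ≤ ∑ i, z ^ f i := by
  rw [← nsmul_eq_mul]
  refine (Finset.card_nsmul_le_sum _ (fun i => z ^ f i) _ ?_).trans ?_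
  · intro i hi
    exact pow_le_pow_of_le_one hz.le hz1 (Finset.mem_filter.1 hi).2
  · exact Finset.sum_le_sum_of_subset_of_nonneg (Finset.subset_univ _)
      (fun i _ _ => pow_nonneg hz.le _)

lemma tail_bound {n : ℕ} (D : Finset (Fin n)) (c : ℝ) (k : ℕ)
    (hD : c * n ≤ D.card) (hk : (k : ℝ) ≤ c / 16 * n) :
    ((Finset.univ.filter (fun p : Finset (Fin n) × Finset (Fin n) =>
      (D ∩ (p.1 ∩ p.2)).card ≤ k)).card : ℝ) ≤ 4 ^ n * Real.exp (-(c / 16 * n)) := by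
  have h := card_le_sum_pow (fun p : Finset (Fin n) × Finset (Fin n) =>
      (D ∩ (p.1 ∩ p.2)).card) k (1 / 2) (by norm_num) (by norm_num)
  rw [sum_pow_inter_two] at h
  have e1 : ((3 + 1 / 2 : ℝ) / 4) ^ D.card ≤ Real.exp (-(D.card / 8)) := by
    have : ((3 + 1 / 2 : ℝ) / 4) ≤ Real.exp (-(1 / 8)) := by
      have := Real.add_one_le_exp (-(1 / 8 : ℝ)); linarith
    calc _ ≤ (Real.exp (-(1 / 8))) ^ D.card := pow_le_pow_left₀ (by norm_num) this _
      _ = _ := by rw [← Real.exp_nat_mul]; congr 1; ring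
  have e2 : Real.exp (-(k : ℝ)) ≤ (1 / 2 : ℝ) ^ k := by
    have h2 : Real.exp (-1) ≤ 1 / 2 := by
      rw [Real.exp_neg, one_div]
      have := Real.add_one_le_exp (1 : ℝ)
      exact inv_anti₀ (by norm_num) (by linarith)
    calc _ = (Real.exp (-1)) ^ k := by rw [← Real.exp_nat_mul]; congr 1; ring
      _ ≤ _ := pow_le_pow_left₀ (Real.exp_pos _).le h2 _
  set N : ℝ := ((Finset.univ.filter (fun p : Finset (Fin n) × Finset (Fin n) =>
      (D ∩ (p.1 ∩ p.2)).card ≤ k)).card : ℝ) with hN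
  have hN0 : 0 ≤ N := Nat.cast_nonneg _
  have h3 : N * Real.exp (-(k : ℝ)) ≤ 4 ^ n * Real.exp (-(D.card / 8)) :=
    (mul_le_mul_of_nonneg_left e2 hN0).trans (h.trans
      (mul_le_mul_of_nonneg_left e1 (by positivity)))
  have h4 : N ≤ 4 ^ n * Real.exp (-(D.card / 8)) * Real.exp k := by
    calc N = N * Real.exp (-(k : ℝ)) * Real.exp k := by
          rw [mul_assoc, ← Real.exp_add]; simp
      _ ≤ _ := mul_le_mul_of_nonneg_right h3 (Real.exp_pos _).le
  refine h4.trans ?_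
  rw [mul_assoc, ← Real.exp_add]
  refine mul_le_mul_of_nonneg_left (Real.exp_le_exp.2 ?_) (by positivity)
  linarith

lemma small_sets (ε : ℝ) (hε : 0 < ε) : ∃ δ : ℝ, 0 < δ ∧ ∀ (n k : ℕ), (k : ℝ) ≤ δ * n →
    ((Finset.univ.filter (fun h : Finset (Fin n) => h.card ≤ k)).card : ℝ) ≤
      Real.exp (ε * n) := by
  set z : ℝ := min (ε / 2) 1 with hz
  have hz0 : 0 < z := lt_min (by linarith) one_pos
  have hz1 : z ≤ 1 := min_le_right _ _
  have hze : z ≤ ε / 2 := min_le_left _ _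
  have hlog : Real.log z ≤ 0 := Real.log_nonpos hz0.le hz1
  have hpos : 0 < 1 - Real.log z := by linarith
  refine ⟨(ε / 2) / (1 - Real.log z), by positivity, ?_⟩
  intro n k hk
  have h := card_le_sum_pow (fun h : Finset (Fin n) => h.card) k z hz0 hz1
  have h2 := sum_pow_inter (Finset.univ : Finset (Fin n)) z
  simp only [Finset.univ_inter, Finset.card_univ, Fintype.card_fin] at h2
  rw [h2, ← mul_pow, mul_div_cancel₀ _ (by norm_num : (2 : ℝ) ≠ 0)] at h
  have e1 : (1 + z) ^ n ≤ Real.exp (ε / 2 * n) := by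
    calc _ ≤ (Real.exp (ε / 2)) ^ n := by
          refine pow_le_pow_left₀ (by linarith) ?_ _
          have := Real.add_one_le_exp (ε / 2); linarith
      _ = _ := by rw [← Real.exp_nat_mul]; congr 1; ring
  have e2 : z ^ k = Real.exp (k * Real.log z) := by
    rw [Real.exp_nat_mul, Real.exp_log hz0]
  rw [e2] at h
  set N : ℝ := ((Finset.univ.filter (fun h : Finset (Fin n) => h.card ≤ k)).card : ℝ)
  have h4 : N ≤ Real.exp (ε / 2 * n) * Real.exp (-(k * Real.log z)) := by
    calc N = N * Real.exp (k * Real.log z) * Real.exp (-(k * Real.log z)) := by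
          rw [mul_assoc, ← Real.exp_add]; simp
      _ ≤ _ := mul_le_mul_of_nonneg_right (h.trans e1) (Real.exp_pos _).le
  refine h4.trans ?_
  rw [← Real.exp_add, Real.exp_le_exp]
  have h5 : (k : ℝ) * (1 - Real.log z) ≤ ε / 2 * n := by
    have := mul_le_mul_of_nonneg_right hk hpos.le
    calc _ ≤ _ := this
      _ = _ := by field_simp
  have : (0 : ℝ) ≤ k := Nat.cast_nonneg _
  nlinarith

lemma ball_card {n : ℕ} (h0 : Finset (Fin n)) (k : ℕ) :
    (Finset.univ.filter (fun h : Finset (Fin n) => (symmDiff h h0).card ≤ k)).card =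
    (Finset.univ.filter (fun h : Finset (Fin n) => h.card ≤ k)).card := by
  refine Finset.card_bij' (fun h _ => symmDiff h h0) (fun h _ => symmDiff h h0) ?_ ?_ ?_ ?_
  · intro h hh; simpa using hh
  · intro h hh; simpa [symmDiff_assoc] using hh
  · intro h hh; simp [symmDiff_assoc]
  · intro h hh; simp [symmDiff_assoc]

lemma two_pow_le_choose (T : ℕ) : ∀ a b : ℕ, T ≤ a → T ≤ b → 2 ^ T ≤ (a + b).choose a := by
  induction T with
  | zero =>
    intro a b _ _
    exact Nat.choose_pos (by omega)
  | succ T ih =>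
    intro a b ha hb
    obtain ⟨a, rfl⟩ : ∃ a', a = a' + 1 := ⟨a - 1, by omega⟩
    obtain ⟨b, rfl⟩ : ∃ b', b = b' + 1 := ⟨b - 1, by omega⟩
    have h1 := ih a (b + 1) (by omega) (by omega)
    have h2 := ih (a + 1) b (by omega) (by omega)
    have e1 : a + 1 + (b + 1) = (a + (b + 1)) + 1 := by ring
    have e2 : a + 1 + b = a + (b + 1) := by ring
    rw [e2] at h2
    rw [e1, Nat.choose_succ_succ', pow_succ]
    omega

lemma exists_perm_image {n : ℕ} (h h' : Finset (Fin n)) (hc : h.card = h'.card) :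
    ∃ τ : Equiv.Perm (Fin n), h.image τ = h' := by
  classical
  obtain ⟨e⟩ : Nonempty ({x // x ∈ h} ≃ {x // x ∈ h'}) := by
    rw [← Fintype.card_eq]; simpa using hc
  refine ⟨e.extendSubtype, ?_⟩
  refine Finset.eq_of_subset_of_card_le ?_ ?_
  · intro x hx
    obtain ⟨y, hy, rfl⟩ := Finset.mem_image.1 hx
    exact e.extendSubtype_mem y hy
  · rw [Finset.card_image_of_injective _ (Equiv.injective _), hc]

lemma perm_fibre {n : ℕ} (F h : Finset (Fin n)) (T : ℕ) (h1 : T ≤ F.card)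
    (h2 : T + F.card ≤ n) :
    (Finset.univ.filter (fun σ : Equiv.Perm (Fin n) => F.image σ = h)).card * 2 ^ T ≤
      n.factorial := by
  classical
  by_cases hc : F.card = h.card
  swap
  · have : Finset.univ.filter (fun σ : Equiv.Perm (Fin n) => F.image σ = h) = ∅ := by
      rw [Finset.filter_eq_empty_iff]
      rintro σ - rfl
      exact hc (Finset.card_image_of_injective _ σ.injective).symm
    simp [this]
  have hsum : ∑ h' ∈ Finset.powersetCard F.card (Finset.univ : Finset (Fin n)),
      (Finset.univ.filter (fun σ : Equiv.Perm (Fin n) => F.image σ = h')).card =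
      n.factorial := by
    have := Finset.card_eq_sum_card_fiberwise (s := (Finset.univ : Finset (Equiv.Perm (Fin n))))
      (t := Finset.powersetCard F.card (Finset.univ : Finset (Fin n)))
      (f := fun σ : Equiv.Perm (Fin n) => F.image σ) (by
        intro σ _
        simp [Finset.mem_powersetCard, Finset.card_image_of_injective _ σ.injective])
    rw [← this, Finset.card_univ, Fintype.card_perm, Fintype.card_fin]
  have hle : ∀ h' ∈ Finset.powersetCard F.card (Finset.univ : Finset (Fin n)),
      (Finset.univ.filter (fun σ : Equiv.Perm (Fin n) => F.image σ = h)).card ≤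
      (Finset.univ.filter (fun σ : Equiv.Perm (Fin n) => F.image σ = h')).card := by
    intro h' hh'
    have hh'c := (Finset.mem_powersetCard.1 hh').2
    obtain ⟨τ, hτ⟩ := exists_perm_image h h' (by omega)
    refine Finset.card_le_card_of_injOn (fun σ => τ * σ) ?_ ?_
    · intro σ hσ
      have hσ : F.image σ = h := by simpa using hσ
      simp only [Finset.coe_filter, Finset.mem_univ, true_and, Set.mem_ofPred_eq]
      rw [← hτ, ← hσ, Finset.image_image]
      rfl
    · intro σ _ σ' _ heq
      exact mul_left_cancel heq
  have h3 := Finset.card_nsmul_le_sum _ _ _ hle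
  rw [hsum, Finset.card_powersetCard, Finset.card_univ, Fintype.card_fin, smul_eq_mul] at h3
  have h4 := two_pow_le_choose T F.card (n - F.card) h1 (by omega)
  rw [Nat.add_sub_cancel' (by omega)] at h4
  calc _ ≤ _ * n.choose F.card := Nat.mul_le_mul_left _ h4
    _ ≤ _ := by rw [mul_comm]; exact h3

end Counting

section Assembly

lemma dF_injective {n : ℕ} : Function.Injective (dF : Finset (Fin n) → Finset (Fin n)) := by
  intro F G h
  have key : ∀ m : ℕ, ∀ q : Fin n, q.val = m → (q ∈ F ↔ q ∈ G) := by
    intro m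
    induction m with
    | zero =>
      intro q hq
      have h1 : q ∈ dF F ↔ q ∈ dF G := by rw [h]
      simp only [dF, Finset.mem_filter, Finset.mem_univ, true_and] at h1
      have h2 : ∀ S : Finset (Fin n), ¬ ∃ q' : Fin n, q'.val + 1 = q.val ∧ q' ∈ S := by
        rintro S ⟨q', h, -⟩; omega
      rw [not_iff_not] at h1
      simp only [h2, iff_false] at h1
      exact not_iff_not.1 h1
    | succ m ih =>
      intro q hq
      have h1 : q ∈ dF F ↔ q ∈ dF G := by rw [h]
      simp only [dF, Finset.mem_filter, Finset.mem_univ, true_and] at h1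
      have h2 : (∃ q' : Fin n, q'.val + 1 = q.val ∧ q' ∈ F) ↔
          (∃ q' : Fin n, q'.val + 1 = q.val ∧ q' ∈ G) := by
        refine exists_congr fun q' => and_congr_right fun hq' => ?_
        exact ih q' (by omega)
      rw [not_iff_not, h2] at h1
      generalize (∃ q' : Fin n, q'.val + 1 = q.val ∧ q' ∈ G) = R at h1
      by_cases hR : R
      · simpa [hR] using h1
      · simp only [hR, iff_false] at h1
        exact not_iff_not.1 h1
  ext q
  exact key _ q rfl

lemma dF_count {n : ℕ} (w : ℕ) :
    (Finset.univ.filter (fun F : Finset (Fin n) => (dF F).card ≤ w)).card ≤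
    (Finset.univ.filter (fun h : Finset (Fin n) => h.card ≤ w)).card := by
  refine Finset.card_le_card_of_injOn dF ?_ dF_injective.injOn
  intro F hF
  simpa using hF

/-- The sample space. -/
abbrev Om (n : ℕ) := Finset (Fin n) × Finset (Fin n) × Equiv.Perm (Fin n) × Equiv.Perm (Fin n)

lemma card_fin_sum {α β : Type} [Fintype α] [Fintype β] (P : α → β → Prop)
    [∀ a b, Decidable (P a b)] :
    (Finset.univ.filter (fun p : α × β => P p.1 p.2)).card =
      ∑ a, (Finset.univ.filter (fun b => P a b)).card := by
  simp only [Finset.card_filter]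
  rw [Fintype.sum_prod_type]

lemma pair_perm_count {n : ℕ} (F G : Finset (Fin n)) (k T : ℕ) (h1 : T ≤ F.card)
    (h2 : T + F.card ≤ n) :
    (Finset.univ.filter (fun p : Equiv.Perm (Fin n) × Equiv.Perm (Fin n) =>
      (symmDiff (F.image p.2) (G.image p.1)).card ≤ k)).card * 2 ^ T ≤
    (Finset.univ.filter (fun h : Finset (Fin n) => h.card ≤ k)).card * n.factorial ^ 2 := by
  classical
  rw [card_fin_sum (fun σb σa : Equiv.Perm (Fin n) =>
    (symmDiff (F.image σa) (G.image σb)).card ≤ k), Finset.sum_mul]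
  have key : ∀ σb : Equiv.Perm (Fin n), (Finset.univ.filter (fun σa : Equiv.Perm (Fin n) =>
      (symmDiff (F.image σa) (G.image σb)).card ≤ k)).card * 2 ^ T ≤
      (Finset.univ.filter (fun h : Finset (Fin n) => h.card ≤ k)).card * n.factorial := by
    intro σb
    rw [← ball_card (G.image σb) k]
    have := Finset.card_eq_sum_card_fiberwise (s := Finset.univ.filter
        (fun σa : Equiv.Perm (Fin n) => (symmDiff (F.image σa) (G.image σb)).card ≤ k))
      (t := Finset.univ.filter (fun h : Finset (Fin n) => (symmDiff h (G.image σb)).card ≤ k))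
      (f := fun σ : Equiv.Perm (Fin n) => F.image σ) (by
        intro σ hσ
        simpa using hσ)
    rw [this, Finset.sum_mul, ← smul_eq_mul (a := Finset.card _)]
    refine Finset.sum_le_card_nsmul _ _ _ ?_
    intro h _
    refine le_trans (Nat.mul_le_mul_right _ (Finset.card_le_card ?_)) (perm_fibre F h T h1 h2)
    intro σ hσ
    simp only [Finset.mem_filter, Finset.mem_univ, true_and] at hσ ⊢
    exact hσ.2
  refine (Finset.sum_le_card_nsmul _ _ _ (fun σb _ => key σb)).trans ?_
  rw [Finset.card_univ, Fintype.card_perm, Fintype.card_fin, smul_eq_mul]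
  apply le_of_eq; ring

/-- Reordering of the sample space. -/
def omEquiv (n : ℕ) : Om n ≃
    (Equiv.Perm (Fin n) × Equiv.Perm (Fin n)) × (Finset (Fin n) × Finset (Fin n)) where
  toFun ω := ((ω.2.2.2, ω.2.2.1), (ω.1, ω.2.1))
  invFun p := (p.2.1, p.2.2, p.1.2, p.1.1)
  left_inv _ := rfl
  right_inv _ := rfl

lemma cut_count {n : ℕ} (F G : Finset (Fin n)) (w k T : ℕ) (c : ℝ) (h1 : T ≤ F.card)
    (h2 : T + F.card ≤ n) (hw : (w : ℝ) ≤ c / 16 * n) (hk : c * n ≤ k + 1) :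
    ((Finset.univ.filter (fun ω : Om n =>
      ((symmDiff (F.image ω.2.2.1) (G.image ω.2.2.2)) ∩ (ω.1 ∩ ω.2.1)).card ≤ w)).card : ℝ) ≤
    4 ^ n * (n.factorial : ℝ) ^ 2 * (Real.exp (-(c / 16 * n)) +
      ((Finset.univ.filter (fun h : Finset (Fin n) => h.card ≤ k)).card : ℝ) / 2 ^ T) := by
  classical
  have e0 : (Finset.univ.filter (fun ω : Om n =>
      ((symmDiff (F.image ω.2.2.1) (G.image ω.2.2.2)) ∩ (ω.1 ∩ ω.2.1)).card ≤ w)).card =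
      (Finset.univ.filter (fun p : (Equiv.Perm (Fin n) × Equiv.Perm (Fin n)) ×
        (Finset (Fin n) × Finset (Fin n)) =>
      ((symmDiff (F.image p.1.2) (G.image p.1.1)) ∩ (p.2.1 ∩ p.2.2)).card ≤ w)).card := by
    refine Finset.card_equiv (omEquiv n) ?_
    intro ω
    simp [omEquiv]
  rw [e0, card_fin_sum (fun (s : Equiv.Perm (Fin n) × Equiv.Perm (Fin n))
    (q : Finset (Fin n) × Finset (Fin n)) =>
      ((symmDiff (F.image s.2) (G.image s.1)) ∩ (q.1 ∩ q.2)).card ≤ w)]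
  push_cast
  have key : ∀ s : Equiv.Perm (Fin n) × Equiv.Perm (Fin n),
      ((Finset.univ.filter (fun q : Finset (Fin n) × Finset (Fin n) =>
      ((symmDiff (F.image s.2) (G.image s.1)) ∩ (q.1 ∩ q.2)).card ≤ w)).card : ℝ) ≤
      4 ^ n * Real.exp (-(c / 16 * n)) +
        4 ^ n * (if (symmDiff (F.image s.2) (G.image s.1)).card ≤ k then 1 else 0) := by
    intro s
    split_ifs with hs
    · have h := Finset.card_le_univ (Finset.univ.filter (fun q : Finset (Fin n) × Finset (Fin n) =>
        ((symmDiff (F.image s.2) (G.image s.1)) ∩ (q.1 ∩ q.2)).card ≤ w))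
      rw [Fintype.card_prod, Fintype.card_finset, Fintype.card_fin, ← mul_pow] at h
      have h' : ((Finset.univ.filter (fun q : Finset (Fin n) × Finset (Fin n) =>
        ((symmDiff (F.image s.2) (G.image s.1)) ∩ (q.1 ∩ q.2)).card ≤ w)).card : ℝ) ≤ 4 ^ n := by
        exact_mod_cast h
      have : (0 : ℝ) ≤ 4 ^ n * Real.exp (-(c / 16 * n)) := by positivity
      linarith
    · rw [mul_zero, add_zero]
      refine tail_bound _ c w ?_ hw
      have : (k : ℝ) + 1 ≤ (symmDiff (F.image s.2) (G.image s.1)).card := by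
        exact_mod_cast (by omega : k + 1 ≤ (symmDiff (F.image s.2) (G.image s.1)).card)
      linarith
  refine (Finset.sum_le_sum (fun s _ => key s)).trans ?_
  rw [Finset.sum_add_distrib, Finset.sum_const, Finset.card_univ,
    Fintype.card_prod, Fintype.card_perm, Fintype.card_fin, ← Finset.mul_sum, Finset.sum_boole, nsmul_eq_mul]
  have h3 := pair_perm_count F G k T h1 h2
  have h4 : ((Finset.univ.filter (fun p : Equiv.Perm (Fin n) × Equiv.Perm (Fin n) =>
      (symmDiff (F.image p.2) (G.image p.1)).card ≤ k)).card : ℝ) ≤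
    ((Finset.univ.filter (fun h : Finset (Fin n) => h.card ≤ k)).card : ℝ) *
      (n.factorial : ℝ) ^ 2 / 2 ^ T := by
    rw [le_div_iff₀ (by positivity)]
    exact_mod_cast h3
  have h5 := mul_le_mul_of_nonneg_left h4 (by positivity : (0 : ℝ) ≤ 4 ^ n)
  push_cast
  refine (add_le_add_right h5 _).trans (le_of_eq ?_)
  ring

lemma badcut_count {n : ℕ} (w k T : ℕ) (c ε : ℝ) (hw : (w : ℝ) ≤ c / 16 * n)
    (hk : c * n ≤ k + 1)
    (hsmall : ((Finset.univ.filter (fun h : Finset (Fin n) => h.card ≤ w)).card : ℝ) ≤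
      Real.exp (ε * n)) (P : Om n → Prop) [DecidablePred P]
    (hP : ∀ ω, P ω → BadCut w T ω.1 ω.2.1 ω.2.2.1 ω.2.2.2 ∧ 4 * T ≤ (ω.1 ∩ ω.2.1).card) :
    ((Finset.univ.filter P).card : ℝ) ≤ Real.exp (2 * ε * n) *
    (4 ^ n * (n.factorial : ℝ) ^ 2 * (Real.exp (-(c / 16 * n)) +
      ((Finset.univ.filter (fun h : Finset (Fin n) => h.card ≤ k)).card : ℝ) / 2 ^ T)) := by
  classical
  set W := Finset.univ.filter (fun F : Finset (Fin n) => (dF F).card ≤ w) with hW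
  set Q : Finset (Finset (Fin n) × Finset (Fin n)) :=
    (W ×ˢ W).filter (fun p => T ≤ p.1.card ∧ T + p.1.card ≤ n) with hQ
  have hWc : (W.card : ℝ) ≤ Real.exp (ε * n) :=
    le_trans (by exact_mod_cast dF_count w) hsmall
  have hQc : (Q.card : ℝ) ≤ Real.exp (2 * ε * n) := by
    have : Q.card ≤ W.card * W.card := by
      rw [← Finset.card_product]; exact Finset.card_filter_le _ _
    calc (Q.card : ℝ) ≤ W.card * W.card := by exact_mod_cast this
      _ ≤ Real.exp (ε * n) * Real.exp (ε * n) :=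
        mul_le_mul hWc hWc (Nat.cast_nonneg _) (Real.exp_pos _).le
      _ = _ := by rw [← Real.exp_add]; congr 1; ring
  have hsub : Finset.univ.filter P ⊆ Q.biUnion (fun p => Finset.univ.filter (fun ω : Om n =>
      ((symmDiff (p.1.image ω.2.2.1) (p.2.image ω.2.2.2)) ∩ (ω.1 ∩ ω.2.1)).card ≤ w)) := by
    intro ω hω
    obtain ⟨⟨F, G, b1, b2, b3, b4, b5⟩, hI⟩ := hP ω (Finset.mem_filter.1 hω).2
    rw [Finset.mem_biUnion]
    refine ⟨(F, G), ?_, by simpa using b3⟩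
    have hF : (F.image ω.2.2.1).card = F.card :=
      Finset.card_image_of_injective _ (Equiv.injective _)
    have s1 : (F.image ω.2.2.1 ∩ (ω.1 ∩ ω.2.1)).card ≤ (F.image ω.2.2.1).card :=
      Finset.card_le_card Finset.inter_subset_left
    have s2 := Finset.card_union_add_card_inter (F.image ω.2.2.1) (ω.1 ∩ ω.2.1)
    have s3 : (F.image ω.2.2.1 ∪ (ω.1 ∩ ω.2.1)).card ≤ n := by
      simpa using Finset.card_le_univ (F.image ω.2.2.1 ∪ (ω.1 ∩ ω.2.1))
    simp only [hQ, hW, Finset.mem_filter, Finset.mem_product, Finset.mem_univ, true_and]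
    refine ⟨⟨b1, b2⟩, by omega, by omega⟩
  have h1 : ((Finset.univ.filter P).card : ℝ) ≤ ∑ p ∈ Q, ((Finset.univ.filter (fun ω : Om n =>
      ((symmDiff (p.1.image ω.2.2.1) (p.2.image ω.2.2.2)) ∩ (ω.1 ∩ ω.2.1)).card ≤ w)).card : ℝ) := by
    exact_mod_cast (Finset.card_le_card hsub).trans Finset.card_biUnion_le
  refine h1.trans ?_
  refine (Finset.sum_le_card_nsmul _ _ _ (fun p hp => cut_count p.1 p.2 w k T c
    (Finset.mem_filter.1 hp).2.1 (Finset.mem_filter.1 hp).2.2 hw hk)).trans ?_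
  rw [nsmul_eq_mul]
  exact mul_le_mul_of_nonneg_right hQc (by positivity)

/-- Events depending only on `A`, `B`. -/
lemma lift_count {n : ℕ} (P : Finset (Fin n) × Finset (Fin n) → Prop) [DecidablePred P] :
    (Finset.univ.filter (fun ω : Om n => P (ω.1, ω.2.1))).card =
      (Finset.univ.filter P).card * n.factorial ^ 2 := by
  classical
  have e0 : (Finset.univ.filter (fun ω : Om n => P (ω.1, ω.2.1))).card =
      ((Finset.univ : Finset (Equiv.Perm (Fin n) × Equiv.Perm (Fin n))) ×ˢ
        (Finset.univ.filter P)).card := by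
    refine Finset.card_equiv (omEquiv n) ?_
    intro ω
    simp [omEquiv]
  rw [e0, Finset.card_product, Finset.card_univ, Fintype.card_prod, Fintype.card_perm,
    Fintype.card_fin]
  ring

lemma inter_count {n : ℕ} (k : ℕ) (hk : (k : ℝ) ≤ 1 / 16 * n) :
    ((Finset.univ.filter (fun ω : Om n => (ω.1 ∩ ω.2.1).card ≤ k)).card : ℝ) ≤
      4 ^ n * (n.factorial : ℝ) ^ 2 * Real.exp (-(1 / 16 * n)) := by
  have h := lift_count (n := n) (fun p => (p.1 ∩ p.2).card ≤ k)
  have h2 := tail_bound (Finset.univ : Finset (Fin n)) 1 k (by simp) hk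
  simp only [Finset.univ_inter] at h2
  rw [h]
  push_cast
  calc _ ≤ _ := mul_le_mul_of_nonneg_right h2 (by positivity)
    _ = _ := by ring

lemma sdiff_count {n : ℕ} (k : ℕ) (hk : (k : ℝ) ≤ 1 / 16 * n) :
    ((Finset.univ.filter (fun ω : Om n => (ω.1 \ ω.2.1).card ≤ k)).card : ℝ) ≤
      4 ^ n * (n.factorial : ℝ) ^ 2 * Real.exp (-(1 / 16 * n)) := by
  refine le_trans (le_of_eq ?_) (inter_count k hk)
  congr 1
  refine Finset.card_equiv ((Equiv.refl _).prodCongr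
    ((Function.Involutive.toPerm compl compl_involutive).prodCongr (Equiv.refl _))) ?_
  intro ω
  simp [Finset.sdiff_eq_inter_compl]

lemma om_card (n : ℕ) : (Fintype.card (Om n) : ℝ) = 4 ^ n * (n.factorial : ℝ) ^ 2 := by
  simp only [Fintype.card_prod, Fintype.card_finset, Fintype.card_perm, Fintype.card_fin]
  push_cast
  rw [show (4 : ℝ) = 2 * 2 by norm_num, mul_pow]
  ring

lemma length_bound (n d k : ℕ) (x μ : ℝ) (hμ : 0 < μ) (hn : 8 ≤ μ * n) (hd : μ * n / 4 ≤ d + 1)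
    (hdk : d = k) (hd8 : d ≤ 8 * n) (hx : 1 ≤ (1 - (d : ℝ) / (8 * n : ℕ)) ^ k * x) :
    (2 : ℝ) ^ (μ ^ 2 / 512 * n) ≤ x := by
  subst hdk
  have hn0 : (0 : ℝ) < n := by
    rcases Nat.eq_zero_or_pos n with h | h
    · subst h; norm_num at hn
    · exact_mod_cast h
  have hd' : μ * n / 8 ≤ d := by linarith
  have hq : 0 ≤ 1 - (d : ℝ) / (8 * n : ℕ) := by
    rw [sub_nonneg, div_le_one (by push_cast; positivity)]
    exact_mod_cast hd8
  have hpow : (1 - (d : ℝ) / (8 * n : ℕ)) ^ d ≤ Real.exp (-(d * (d / (8 * n : ℕ)))) := by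
    calc _ ≤ (Real.exp (-((d : ℝ) / (8 * n : ℕ)))) ^ d :=
          pow_le_pow_left₀ hq (Real.one_sub_le_exp_neg _) _
      _ = _ := by rw [← Real.exp_nat_mul]; congr 1; ring
  have hx0 : 0 < x := by
    by_contra hneg
    have := mul_nonpos_of_nonneg_of_nonpos (pow_nonneg hq d) (not_lt.1 hneg)
    linarith
  have h1 : 1 ≤ Real.exp (-(d * (d / (8 * n : ℕ)))) * x :=
    hx.trans (mul_le_mul_of_nonneg_right hpow hx0.le)
  have h2 : Real.exp (d * (d / (8 * n : ℕ))) ≤ x := by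
    rw [Real.exp_neg, inv_mul_eq_div, one_le_div (Real.exp_pos _)] at h1
    exact h1
  refine le_trans ?_ h2
  rw [Real.rpow_def_of_pos (by norm_num), Real.exp_le_exp]
  have hl : Real.log 2 ≤ 1 := by have := Real.log_two_lt_d9; linarith
  have h3 : μ ^ 2 / 512 * n ≤ d * (d / (8 * n : ℕ)) := by
    rw [← mul_div_assoc, le_div_iff₀ (by push_cast; positivity)]
    push_cast
    have : (μ * n / 8) * (μ * n / 8) ≤ d * d := mul_le_mul hd' hd' (by positivity) (by positivity)
    nlinarith
  calc _ ≤ 1 * (μ ^ 2 / 512 * n) := mul_le_mul_of_nonneg_right hl (by positivity)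
    _ ≤ _ := by rw [one_mul]; exact h3

end Assembly

/-- There is a constant `α > 0` such that, when `A`, `B` are independent
uniformly random subsets of `{x_1,…,x_n}` and `σa`, `σb` are independent uniformly
random orderings (modeled by uniformly random permutations of `{1,…,n}` inducing the
orderings of `A` and `B`), with probability tending to `1` as `n → ∞`: `|A| ≥ 4`,
`|B| ≥ 4`, `|A △ B| ≥ 4` (so `rAddPar(a,b)` is defined) and every resolution refutation
of `rAddPar(a, b)` has length at least `2^(αn)`. -/
theorem rAddPar_resolution_lower_bound_whp :
    ∃ α : ℝ, 0 < α ∧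
      Filter.Tendsto
        (fun n : ℕ =>
          (Nat.card {ω : Finset (Fin n) × Finset (Fin n) ×
              Equiv.Perm (Fin n) × Equiv.Perm (Fin n) //
              4 ≤ ω.1.card ∧ 4 ≤ ω.2.1.card ∧ 4 ≤ (symmDiff ω.1 ω.2.1).card ∧
              ∀ L : List (Clause ℕ),
                IsResRefutation (rAddPar n ω.1 ω.2.1 ω.2.2.1 ω.2.2.2 (Equiv.refl (Fin n))) L →
                  (2 : ℝ) ^ (α * n) ≤ (L.length : ℝ)} : ℝ) /
            (Nat.card (Finset (Fin n) × Finset (Fin n) ×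
              Equiv.Perm (Fin n) × Equiv.Perm (Fin n)) : ℝ))
        Filter.atTop (nhds 1) := by
  classical
  obtain ⟨δ, hδ, hball⟩ := small_sets (1 / 256) (by norm_num)
  set c : ℝ := min δ (1 / 16) with hc
  have hc0 : 0 < c := lt_min hδ (by norm_num)
  have hcδ : c ≤ δ := min_le_left _ _
  have hc16 : c ≤ 1 / 16 := min_le_right _ _
  obtain ⟨δ2, hδ2, hsm⟩ := small_sets (c / 64) (by positivity)
  set μ : ℝ := min δ2 (c / 16) with hμdef
  have hμ : 0 < μ := lt_min hδ2 (by positivity)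
  have hμδ : μ ≤ δ2 := min_le_left _ _
  have hμc : μ ≤ c / 16 := min_le_right _ _
  refine ⟨μ ^ 2 / 512, by positivity, ?_⟩
  set err : ℕ → ℝ := fun n => 2 * Real.exp (-(1 / 16 * n)) + 3 * Real.exp (-(c / 32 * n)) with herr
  have herr0 : Filter.Tendsto (fun n => 1 - err n) Filter.atTop (nhds 1) := by
    have hexp : ∀ a : ℝ, 0 < a →
        Filter.Tendsto (fun n : ℕ => Real.exp (-(a * n))) Filter.atTop (nhds 0) := by
      intro a ha
      exact Real.tendsto_exp_neg_atTop_nhds_zero.comp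
        (tendsto_natCast_atTop_atTop.const_mul_atTop ha)
    have h1 := (hexp (1 / 16) (by norm_num)).const_mul 2
    have h2 := (hexp (c / 32) (by positivity)).const_mul 3
    have h3 := (h1.add h2).const_sub 1
    simpa [herr] using h3
  refine tendsto_of_tendsto_of_tendsto_of_le_of_le' herr0 tendsto_const_nhds ?_ ?_
  swap
  · refine Filter.Eventually.of_forall fun n => ?_
    refine div_le_one_of_le₀ ?_ (Nat.cast_nonneg _)
    exact_mod_cast Finite.card_subtype_le _
  have hlarge : ∀ᶠ n : ℕ in Filter.atTop, 192 ≤ n ∧ 8 ≤ μ * n := by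
    refine (Filter.eventually_ge_atTop 192).and ?_
    exact (tendsto_natCast_atTop_atTop.const_mul_atTop hμ).eventually_ge_atTop 8
  filter_upwards [hlarge] with n hn
  obtain ⟨hn1, hn2⟩ := hn
  have hnR : (192 : ℝ) ≤ n := by exact_mod_cast hn1
  set w : ℕ := ⌊μ * n⌋₊ with hw
  set d : ℕ := ⌊μ * n / 4⌋₊ with hd
  set T : ℕ := n / 64 with hT
  set k : ℕ := ⌊c * n⌋₊ with hk
  have hw1 : (w : ℝ) ≤ μ * n := Nat.floor_le (by positivity)
  have hw2 : μ * n < w + 1 := Nat.lt_floor_add_one _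
  have hd1 : (d : ℝ) ≤ μ * n / 4 := Nat.floor_le (by positivity)
  have hd2 : μ * n / 4 < d + 1 := Nat.lt_floor_add_one _
  have hk1 : (k : ℝ) ≤ c * n := Nat.floor_le (by positivity)
  have hk2 : c * n < k + 1 := Nat.lt_floor_add_one _
  have hkd : d + d + 3 ≤ w := by
    have : ((d + d + 3 : ℕ) : ℝ) < ((w + 1 : ℕ) : ℝ) := by push_cast; linarith
    have := Nat.cast_lt.1 this
    omega
  have hn0 : (0 : ℝ) < n := by linarith
  have hd8 : d ≤ 8 * n := by
    have : (d : ℝ) ≤ ((8 * n : ℕ) : ℝ) := by push_cast; nlinarith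
    exact_mod_cast this
  set m : ℕ := n / 16 with hm
  have hm1 : (m : ℝ) ≤ 1 / 16 * n := by
    have : ((16 * m : ℕ) : ℝ) ≤ n := by exact_mod_cast (by omega : 16 * m ≤ n)
    push_cast at this; linarith
  set Pg : Om n → Prop := fun ω =>
      4 ≤ ω.1.card ∧ 4 ≤ ω.2.1.card ∧ 4 ≤ (symmDiff ω.1 ω.2.1).card ∧
              ∀ L : List (Clause ℕ),
                IsResRefutation (rAddPar n ω.1 ω.2.1 ω.2.2.1 ω.2.2.2 (Equiv.refl (Fin n))) L →
                  (2 : ℝ) ^ (μ ^ 2 / 512 * n) ≤ (L.length : ℝ) with hPg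
  set B1 := Finset.univ.filter (fun ω : Om n => (ω.1 ∩ ω.2.1).card ≤ m) with hB1
  set B2 := Finset.univ.filter (fun ω : Om n => (ω.1 \ ω.2.1).card ≤ m) with hB2
  set B3 := Finset.univ.filter (fun ω : Om n =>
    BadCut w T ω.1 ω.2.1 ω.2.2.1 ω.2.2.2 ∧ 4 * T ≤ (ω.1 ∩ ω.2.1).card) with hB3
  have hcover : (Finset.univ : Finset (Om n)) ⊆ Finset.univ.filter Pg ∪ (B1 ∪ B2 ∪ B3) := by
    intro ω _
    simp only [Finset.mem_union, hB1, hB2, hB3, Finset.mem_filter, Finset.mem_univ, true_and]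
    by_contra hcon
    push Not at hcon
    obtain ⟨hnP, ⟨hI, hS⟩, hcut⟩ := hcon
    apply hnP
    have hcut' : ¬ BadCut w T ω.1 ω.2.1 ω.2.2.1 ω.2.2.2 := fun h => by
      have := hcut h
      omega
    have a1 : (ω.1 ∩ ω.2.1).card ≤ ω.1.card := Finset.card_le_card Finset.inter_subset_left
    have a2 : (ω.1 ∩ ω.2.1).card ≤ ω.2.1.card := Finset.card_le_card Finset.inter_subset_right
    have a3 : (ω.1 \ ω.2.1).card ≤ (symmDiff ω.1 ω.2.1).card := Finset.card_le_card (by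
      intro x hx
      rw [Finset.mem_symmDiff]
      exact Or.inl (Finset.mem_sdiff.1 hx))
    obtain ⟨i0, hi0⟩ : (ω.1 \ ω.2.1).Nonempty := Finset.card_pos.1 (by omega)
    rw [Finset.mem_sdiff] at hi0
    refine ⟨by omega, by omega, by omega, ?_⟩
    intro L hL
    exact length_bound n d d _ μ hμ hn2 hd2.le rfl hd8
      (det_bound ω.1 ω.2.1 ω.2.2.1 ω.2.2.2 (Equiv.refl (Fin n)) w d d T (by omega) (by omega)
        (by omega) i0 hi0.1 hi0.2 (by omega) (by omega) hcut' hkd hd8 L hL)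
  have hb1 : (B1.card : ℝ) ≤ _ := inter_count m hm1
  have hb2 : (B2.card : ℝ) ≤ _ := sdiff_count m hm1
  have hb3 : (B3.card : ℝ) ≤ _ := badcut_count w k T c (c / 64)
    (hw1.trans (mul_le_mul_of_nonneg_right hμc hn0.le)) hk2.le
    (hsm n w (hw1.trans (mul_le_mul_of_nonneg_right hμδ hn0.le)))
    (fun ω : Om n => BadCut w T ω.1 ω.2.1 ω.2.2.1 ω.2.2.2 ∧ 4 * T ≤ (ω.1 ∩ ω.2.1).card)
    (fun ω h => h)
  have hballk := hball n k (hk1.trans (mul_le_mul_of_nonneg_right hcδ hn0.le))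
  have h2T : Real.exp (1 / 128 * n) ≤ 2 * 2 ^ T := by
    have e1 : Real.exp (1 / 2) ≤ 2 := by
      rw [← Real.le_log_iff_exp_le (by norm_num)]
      have := Real.log_two_gt_d9; linarith
    have e2 : (n : ℝ) ≤ 64 * (T + 1) := by
      exact_mod_cast (by omega : n ≤ 64 * (T + 1))
    calc Real.exp (1 / 128 * n) ≤ Real.exp ((T + 1 : ℕ) * (1 / 2)) := by
          rw [Real.exp_le_exp]; push_cast; linarith
      _ = Real.exp (1 / 2) ^ (T + 1) := by rw [Real.exp_nat_mul]
      _ ≤ 2 ^ (T + 1) := pow_le_pow_left₀ (Real.exp_pos _).le e1 _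
      _ = _ := by ring
  have hratio : ((Finset.univ.filter (fun h : Finset (Fin n) => h.card ≤ k)).card : ℝ) / 2 ^ T ≤
      2 * Real.exp (-(c / 16 * n)) := by
    rw [div_le_iff₀ (by positivity)]
    have e3 : Real.exp (-(c / 16 * n)) ≥ Real.exp (-(1 / 256 * n)) := by
      rw [ge_iff_le, Real.exp_le_exp]
      nlinarith
    have e4 : Real.exp (1 / 256 * n) = Real.exp (-(1 / 256 * n)) * Real.exp (1 / 128 * n) := by
      rw [← Real.exp_add]; congr 1; ring
    calc _ ≤ Real.exp (1 / 256 * n) := hballk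
      _ = Real.exp (-(1 / 256 * n)) * Real.exp (1 / 128 * n) := e4
      _ ≤ Real.exp (-(c / 16 * n)) * (2 * 2 ^ T) :=
        mul_le_mul e3 h2T (Real.exp_pos _).le (Real.exp_pos _).le
      _ = _ := by ring
  set N : ℝ := 4 ^ n * (n.factorial : ℝ) ^ 2 with hN
  have hNpos : 0 < N := by positivity
  have hb3' : (B3.card : ℝ) ≤ N * (3 * Real.exp (-(c / 32 * n))) := by
    refine hb3.trans ?_
    have e5 : Real.exp (-(c / 16 * n)) +
        ((Finset.univ.filter (fun h : Finset (Fin n) => h.card ≤ k)).card : ℝ) / 2 ^ T ≤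
        3 * Real.exp (-(c / 16 * n)) := by linarith
    have e6 : Real.exp (2 * (c / 64) * n) * Real.exp (-(c / 16 * n)) =
        Real.exp (-(c / 32 * n)) := by
      rw [← Real.exp_add]; congr 1; ring
    calc _ ≤ Real.exp (2 * (c / 64) * n) * (N * (3 * Real.exp (-(c / 16 * n)))) :=
          mul_le_mul_of_nonneg_left (mul_le_mul_of_nonneg_left e5 hNpos.le) (Real.exp_pos _).le
      _ = N * (3 * (Real.exp (2 * (c / 64) * n) * Real.exp (-(c / 16 * n)))) := by ring
      _ = _ := by rw [e6]
  have hcard : Fintype.card (Om n) ≤ (Finset.univ.filter Pg).card + (B1.card + B2.card + B3.card) := by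
    rw [← Finset.card_univ]
    refine (Finset.card_le_card hcover).trans ((Finset.card_union_le _ _).trans ?_)
    have u1 := Finset.card_union_le (B1 ∪ B2) B3
    have u2 := Finset.card_union_le B1 B2
    omega
  have hcardR : (Fintype.card (Om n) : ℝ) ≤
      (Finset.univ.filter Pg).card + (B1.card + B2.card + B3.card) := by exact_mod_cast hcard
  have hgood : Nat.card {ω : Om n // Pg ω} = (Finset.univ.filter Pg).card := by
    rw [Nat.card_eq_fintype_card, Fintype.card_subtype]
  have htot : (Nat.card (Om n) : ℝ) = N := by
    rw [Nat.card_eq_fintype_card, om_card]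
  rw [om_card] at hcardR
  change 1 - err n ≤ (Nat.card {ω : Om n // Pg ω} : ℝ) / (Nat.card (Om n) : ℝ)
  rw [htot, hgood, le_div_iff₀ hNpos]
  simp only [herr]
  nlinarith
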